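/- Let 0 < ε < 1, 0 < μ ≤ 1 and C > 0 be constants. There exist constants r₀ and c (depending only on C, ε and μ) such that the following holds for all sufficiently large n. Let A be an n×n real matrix with ρ := ρ_b^{(μ)}(A) ≥ n^{−C}, and let y = (y₁,…,yₙ) be a vector of iid copies of η^μ. Then with probability at least (3/4)·ρ over y, there exist a proper symmetric GAP Q_y of rank at most r₀ and size at most c/ρ, and a set I_y ⊆ {1,…,n} with |I_y| ≥ n − n^ε, such that ⟨row_i(A), y⟩ ∈ Q_y for every i ∈ I_y, where ⟨row_i(A), y⟩ = Σ_j A(i,j)y_j. -/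

import Mathlib

open scoped Classical BigOperators

noncomputable section

/-- `Q` is a proper symmetric generalized arithmetic progression (GAP) of rank at most `r`
and size at most `s`. -/
def IsProperSymGAPSet (Q : Set ℝ) (r : ℕ) (s : ℝ) : Prop :=
  ∃ (r' : ℕ) (g : Fin r' → ℝ) (N : Fin r' → ℕ),
    r' ≤ r ∧
    Q = {x : ℝ | ∃ m : Fin r' → ℤ, (∀ i, |m i| ≤ (N i : ℤ)) ∧ x = ∑ i, (m i : ℝ) * g i} ∧
    (∀ m m' : Fin r' → ℤ, (∀ i, |m i| ≤ (N i : ℤ)) → (∀ i, |m' i| ≤ (N i : ℤ)) →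
      (∑ i, (m i : ℝ) * g i) = (∑ i, (m' i : ℝ) * g i) → m = m') ∧
    (∏ i, (2 * (N i : ℝ) + 1)) ≤ s

/-- The three possible values of the lazy sign `η^μ`: `+1`, `-1`, `0`. -/
def etaV : Fin 3 → ℝ := ![1, -1, 0]

/-- The corresponding probability weights: `μ/2`, `μ/2`, `1 - μ`. -/
def etaW (μ : ℝ) : Fin 3 → ℝ := ![μ / 2, μ / 2, 1 - μ]

/-- Probability of an event for a family of iid copies of `η^μ`, indexed by a finite
type. -/
def probEta (μ : ℝ) {ι : Type} [Fintype ι] (E : (ι → ℝ) → Prop) : ℝ :=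
  ∑ s : ι → Fin 3, (∏ i, etaW μ (s i)) * (if E fun i => etaV (s i) then 1 else 0)

/-- The weighted bilinear concentration probability
`ρ_b^{(μ)}(A) = sup_a P(Σ a_{ij} x_i y_j = a)`. -/
def rhoBmu (μ : ℝ) (n : ℕ) (A : Matrix (Fin n) (Fin n) ℝ) : ℝ :=
  ⨆ a : ℝ, probEta μ (fun xy : (Fin n ⊕ Fin n) → ℝ =>
    ∑ i, ∑ j, A i j * xy (Sum.inl i) * xy (Sum.inr j) = a)

/-- Rounding: an element of the image of a subgroup `Λ ∋ u` in the quotient by the line `ℝ u`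
lifts to an element of `Λ` whose norm is not much larger. -/
theorem exists_lift_norm_le {E : Type} [NormedAddCommGroup E] [NormedSpace ℝ E]
    (Λ : AddSubgroup E) (u : E) (hu : u ∈ Λ) (a : E) (ha : a ∈ Λ) {δ : ℝ} (hδ : 0 < δ) :
    ∃ b ∈ Λ, (∃ k : ℤ, b = a + k • u) ∧
      ‖b‖ ≤ ‖(Submodule.Quotient.mk a : E ⧸ (Submodule.span ℝ {u}))‖ + ‖u‖ / 2 + δ := by
  obtain ⟨m, hm, hlt⟩ := Submodule.Quotient.norm_mk_lt
    (S := Submodule.span ℝ {u}) (Submodule.Quotient.mk a) hδ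
  rw [Submodule.Quotient.eq, Submodule.mem_span_singleton] at hm
  obtain ⟨t, ht⟩ := hm
  refine ⟨a + (round t) • u, Λ.add_mem ha (Λ.zsmul_mem hu _), ⟨_, rfl⟩, ?_⟩
  have hsplit : a + (round t) • u = m + (-(t - round t)) • u := by
    have : m = a + t • u := by rw [ht]; abel
    rw [this, ← Int.cast_smul_eq_zsmul ℝ]
    module
  have h1 : ‖(-(t - round t)) • u‖ ≤ ‖u‖ / 2 := by
    rw [norm_smul, norm_neg, Real.norm_eq_abs]
    have := abs_sub_round t
    nlinarith [norm_nonneg u]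
  rw [hsplit]
  linarith [norm_add_le m ((-(t - round t)) • u)]

theorem finrank_quotient_span_singleton_le {E : Type} [NormedAddCommGroup E] [NormedSpace ℝ E]
    [FiniteDimensional ℝ E] {t : ℕ} (h : Module.finrank ℝ E ≤ t + 1) {u : E} (hu : u ≠ 0) :
    Module.finrank ℝ (E ⧸ (Submodule.span ℝ {u})) ≤ t := by
  have h1 := Submodule.finrank_quotient_add_finrank (Submodule.span ℝ {u})
  rw [finrank_span_singleton hu] at h1
  omega

/-- The points of norm at most `R` of a discrete subgroup of a `t`-dimensional normed space lie
in a proper symmetric GAP of rank at most `t` inside a ball of comparable radius. -/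
theorem exists_gap_of_discrete (t : ℕ) : ∃ C : ℝ, 1 ≤ C ∧
    ∀ (E : Type) [NormedAddCommGroup E] [NormedSpace ℝ E] [FiniteDimensional ℝ E],
      Module.finrank ℝ E ≤ t → ∀ (Λ : AddSubgroup E) (R : ℝ), 0 ≤ R →
      {x : E | x ∈ Λ ∧ ‖x‖ ≤ 2 ^ t * R}.Finite →
      ∃ (r : ℕ) (u : Fin r → E) (N : Fin r → ℕ), r ≤ t ∧ (∀ i, u i ∈ Λ) ∧
        (∀ m : Fin r → ℤ, (∀ i, |m i| ≤ (N i : ℤ)) → ‖∑ i, m i • u i‖ ≤ C * R) ∧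
        (∀ m : Fin r → ℤ, ∑ i, m i • u i = 0 → m = 0) ∧
        (∀ x ∈ Λ, ‖x‖ ≤ R → ∃ m : Fin r → ℤ, (∀ i, |m i| ≤ (N i : ℤ)) ∧ x = ∑ i, m i • u i) := by
  induction t with
  | zero =>
    refine ⟨1, le_rfl, ?_⟩
    intro E _ _ _ hE Λ R hR hfin
    have hs : Subsingleton E := Module.finrank_zero_iff.1 (Nat.le_zero.1 hE)
    refine ⟨0, Fin.elim0, Fin.elim0, le_rfl, fun i => i.elim0, ?_, ?_, ?_⟩
    · intro m _; simpa using hR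
    · intro m _; ext i; exact i.elim0
    · intro x _ _; exact ⟨Fin.elim0, fun i => i.elim0, Subsingleton.elim _ _⟩
  | succ t ih =>
    obtain ⟨C, hC1, ih⟩ := ih
    refine ⟨1 + 6 * t * C, by have : 0 ≤ 6 * (t:ℝ) * C := by positivity
                              linarith, ?_⟩
    intro E _ _ _ hE Λ R hR hfin
    by_cases hsmall : ∀ x ∈ Λ, ‖x‖ ≤ R → x = 0
    · refine ⟨0, Fin.elim0, Fin.elim0, Nat.zero_le _, fun i => i.elim0, ?_, ?_, ?_⟩
      · intro m _
        simp only [Finset.univ_eq_empty, Finset.sum_empty, norm_zero]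
        positivity
      · intro m _; ext i; exact i.elim0
      · intro x hx hxR; exact ⟨Fin.elim0, fun i => i.elim0, by simp [hsmall x hx hxR]⟩
    push Not at hsmall
    obtain ⟨x₀, hx₀, hx₀R, hx₀0⟩ := hsmall
    have hpow : (1:ℝ) ≤ 2 ^ t := one_le_pow₀ (by norm_num)
    -- a shortest nonzero vector
    obtain ⟨u, ⟨⟨huΛ, huR'⟩, hu0⟩, humin⟩ := Set.exists_min_image
      ({x : E | x ∈ Λ ∧ ‖x‖ ≤ 2 ^ (t+1) * R} \ {0}) (fun x => ‖x‖) (hfin.sdiff)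
      ⟨x₀, ⟨hx₀, by rw [pow_succ]; nlinarith⟩, hx₀0⟩
    have hu0 : u ≠ 0 := hu0
    have huR : ‖u‖ ≤ R := (humin x₀ ⟨⟨hx₀, by rw [pow_succ]; nlinarith⟩, hx₀0⟩).trans hx₀R
    have humin : ∀ x ∈ Λ, x ≠ 0 → ‖u‖ ≤ ‖x‖ := by
      intro x hx hx0
      by_cases h : ‖x‖ ≤ 2 ^ (t+1) * R
      · exact humin x ⟨⟨hx, h⟩, hx0⟩
      · linarith
    have hupos : 0 < ‖u‖ := norm_pos_iff.2 hu0
    have hRpos : 0 < R := hupos.trans_le huR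
    set W := Submodule.span ℝ {u} with hW
    have : IsClosed (W : Set E) := W.closed_of_finiteDimensional
    set Λ₁ : AddSubgroup (E ⧸ W) := Λ.map W.mkQ.toAddMonoidHom with hΛ₁
    have hπ : ∀ x ∈ Λ, (Submodule.Quotient.mk x : E ⧸ W) ∈ Λ₁ := fun x hx => ⟨x, hx, rfl⟩
    have hπu : ∀ k : ℤ, (Submodule.Quotient.mk (k • u) : E ⧸ W) = 0 := by
      intro k
      rw [Submodule.Quotient.mk_eq_zero, ← Int.cast_smul_eq_zsmul ℝ]
      exact W.smul_mem _ (Submodule.mem_span_singleton_self u)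
    have hlift : ∀ y ∈ Λ₁, ∀ δ : ℝ, 0 < δ → ∃ b ∈ Λ, (Submodule.Quotient.mk b : E ⧸ W) = y ∧
        ‖b‖ ≤ ‖y‖ + ‖u‖ / 2 + δ := by
      rintro y ⟨a, ha, rfl⟩ δ hδ
      obtain ⟨b, hb, ⟨k, hk⟩, hn⟩ := exists_lift_norm_le Λ u huΛ a ha hδ
      refine ⟨b, hb, ?_, hn⟩
      rw [hk, Submodule.Quotient.mk_add, hπu, add_zero]; rfl
    have hnorm : ∀ x : E, ‖(Submodule.Quotient.mk x : E ⧸ W)‖ ≤ ‖x‖ :=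
      fun x => Submodule.Quotient.norm_mk_le W x
    have hfin₁ : {y : E ⧸ W | y ∈ Λ₁ ∧ ‖y‖ ≤ 2 ^ t * R}.Finite := by
      refine (hfin.image (fun x => (Submodule.Quotient.mk x : E ⧸ W))).subset ?_
      rintro y ⟨hy, hyR⟩
      obtain ⟨b, hb, hby, hbn⟩ := hlift y hy (R/2) (by positivity)
      refine ⟨b, ⟨hb, ?_⟩, hby⟩
      rw [pow_succ]; nlinarith
    obtain ⟨r, u₁, N, hr, hu₁, hbox, hind, hcov⟩ :=
      ih (E ⧸ W) (finrank_quotient_span_singleton_le hE hu0) Λ₁ R hR hfin₁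
    have hu₁0 : ∀ i, u₁ i ≠ 0 := by
      intro i hi
      have := hind (Pi.single i 1) (by
        rw [Finset.sum_eq_single i] <;> simp +contextual [hi])
      have := congrFun this i
      simp at this
    have hlow : ∀ y ∈ Λ₁, y ≠ 0 → ‖u‖ ≤ 2 * ‖y‖ := by
      intro y hy hy0
      by_contra hcon
      push Not at hcon
      obtain ⟨b, hb, hby, hbn⟩ := hlift y hy ((‖u‖ / 2 - ‖y‖)/2) (by linarith)
      have : b ≠ 0 := by rintro rfl; exact hy0 (by rw [← hby]; rfl)
      linarith [humin b hb this]
    have hch : ∀ i, ∃ b ∈ Λ, (Submodule.Quotient.mk b : E ⧸ W) = u₁ i ∧ ‖b‖ ≤ 3 * ‖u₁ i‖ := by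
      intro i
      obtain ⟨b, hb, hby, hbn⟩ := hlift (u₁ i) (hu₁ i) (‖u‖/2) (by positivity)
      exact ⟨b, hb, hby, by linarith [hlow _ (hu₁ i) (hu₁0 i)]⟩
    choose w hwΛ hwπ hwn using hch
    have hNu : ∀ i, (N i : ℝ) * ‖u₁ i‖ ≤ C * R := by
      intro i
      have := hbox (Pi.single i (N i : ℤ)) (by
        intro j; by_cases h : j = i
        · subst h; simp
        · simp [h])
      rw [Finset.sum_eq_single i] at this
      · rw [Pi.single_eq_same, ← Int.cast_smul_eq_zsmul ℝ, norm_smul] at this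
        simpa using this
      · intro j _ hj; simp [hj]
      · simp
    have hwbox : ∀ m : Fin r → ℤ, (∀ i, |m i| ≤ (N i : ℤ)) → ‖∑ i, m i • w i‖ ≤ 3 * t * C * R := by
      intro m hm
      calc ‖∑ i, m i • w i‖ ≤ ∑ i, ‖m i • w i‖ := norm_sum_le _ _
        _ ≤ ∑ i : Fin r, 3 * (C * R) := by
          refine Finset.sum_le_sum fun i _ => ?_
          rw [← Int.cast_smul_eq_zsmul ℝ, norm_smul, Real.norm_eq_abs]
          have h1 : |(m i : ℝ)| ≤ N i := by exact_mod_cast hm i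
          have h2 := hwn i
          have h3 := hNu i
          calc |(m i : ℝ)| * ‖w i‖ ≤ N i * (3 * ‖u₁ i‖) := by gcongr
            _ ≤ _ := by linarith
        _ = r * (3 * (C * R)) := by simp
        _ ≤ t * (3 * (C * R)) := by
          have : (r:ℝ) ≤ t := by exact_mod_cast hr
          gcongr
        _ = _ := by ring
    have hπsum : ∀ m : Fin r → ℤ, (Submodule.Quotient.mk (∑ i, m i • w i) : E ⧸ W)
        = ∑ i, m i • u₁ i := by
      intro m
      have : W.mkQ (∑ i, m i • w i) = ∑ i, m i • u₁ i := by
        rw [map_sum]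
        refine Finset.sum_congr rfl fun i _ => ?_
        rw [map_zsmul, ← hwπ i]; rfl
      exact this
    set N₀ : ℕ := ⌊(1 + 3 * t * C) * R / ‖u‖⌋₊ with hN₀
    have hN₀le : (N₀ : ℝ) * ‖u‖ ≤ (1 + 3 * t * C) * R := by
      rw [← le_div_iff₀ hupos]
      exact Nat.floor_le (by positivity)
    refine ⟨r + 1, Fin.cons u w, Fin.cons N₀ N, by omega, ?_, ?_, ?_, ?_⟩
    · intro i
      refine Fin.cases ?_ (fun j => ?_) i
      · exact huΛ
      · exact hwΛ j
    · intro m hm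
      rw [Fin.sum_univ_succ]
      simp only [Fin.cons_zero, Fin.cons_succ]
      have h0 : |(m 0 : ℝ)| ≤ N₀ := by
        have := hm 0
        simp only [Fin.cons_zero] at this
        exact_mod_cast this
      have h1 := hwbox (fun i => m i.succ) (fun i => by simpa using hm i.succ)
      have h2 : ‖m 0 • u‖ ≤ N₀ * ‖u‖ := by
        rw [← Int.cast_smul_eq_zsmul ℝ, norm_smul, Real.norm_eq_abs]
        gcongr
      have := norm_add_le (m 0 • u) (∑ i : Fin r, m i.succ • w i)
      nlinarith [mul_nonneg (mul_nonneg (Nat.cast_nonneg (α := ℝ) t) (zero_le_one.trans hC1)) hR]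
    · intro m hm
      rw [Fin.sum_univ_succ] at hm
      simp only [Fin.cons_zero, Fin.cons_succ] at hm
      have h1 : (fun i : Fin r => m i.succ) = 0 := by
        apply hind
        rw [← hπsum]
        have := congrArg (fun x => (Submodule.Quotient.mk x : E ⧸ W)) hm
        simpa only [Submodule.Quotient.mk_add, hπu, zero_add, Submodule.Quotient.mk_zero] using this
      have h2 : m 0 = 0 := by
        have h3 : ∀ i : Fin r, m i.succ = 0 := fun i => congrFun h1 i
        simp only [h3, zero_smul, Finset.sum_const_zero, add_zero] at hm
        rw [← Int.cast_smul_eq_zsmul ℝ] at hm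
        rcases smul_eq_zero.1 hm with h | h
        · exact_mod_cast h
        · exact absurd h hu0
      ext i
      refine Fin.cases h2 (fun j => congrFun h1 j) i
    · intro x hx hxR
      obtain ⟨m, hm, hmx⟩ := hcov _ (hπ x hx) ((hnorm x).trans hxR)
      have hmem : x - ∑ i, m i • w i ∈ W := by
        rw [← Submodule.Quotient.eq, hπsum, hmx]
      obtain ⟨τ, hτ⟩ := Submodule.mem_span_singleton.1 hmem
      have hΛ' : x - ∑ i, m i • w i ∈ Λ :=
        Λ.sub_mem hx (Λ.sum_mem fun i _ => Λ.zsmul_mem (hwΛ i) _)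
      have hzer : (τ - round τ) • u = 0 := by
        by_contra hne
        have h1 : (τ - round τ) • u ∈ Λ := by
          rw [sub_smul, hτ, Int.cast_smul_eq_zsmul]
          exact Λ.sub_mem hΛ' (Λ.zsmul_mem huΛ _)
        have h2 := humin _ h1 hne
        rw [norm_smul, Real.norm_eq_abs] at h2
        nlinarith [abs_sub_round τ]
      have hτ' : round τ • u = x - ∑ i, m i • w i := by
        rw [sub_smul, hτ, Int.cast_smul_eq_zsmul, sub_eq_zero] at hzer
        exact hzer.symm
      refine ⟨Fin.cons (round τ) m, ?_, ?_⟩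
      · intro i
        refine Fin.cases ?_ (fun j => ?_) i
        · simp only [Fin.cons_zero]
          have h1 : ‖round τ • u‖ ≤ (1 + 3 * t * C) * R := by
            rw [hτ']
            have := norm_sub_le x (∑ i, m i • w i)
            linarith [hwbox m hm]
          rw [← Int.cast_smul_eq_zsmul ℝ, norm_smul, Real.norm_eq_abs, ← le_div_iff₀ hupos] at h1
          have h2 : ((round τ).natAbs : ℝ) ≤ (1 + 3 * t * C) * R / ‖u‖ := by
            rw [Nat.cast_natAbs]; push_cast; exact h1
          have h3 : (round τ).natAbs ≤ N₀ := Nat.le_floor h2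
          rw [Int.abs_eq_natAbs]; exact_mod_cast h3
        · simpa using hm j
      · rw [Fin.sum_univ_succ]
        simp only [Fin.cons_zero, Fin.cons_succ]
        rw [hτ']; abel

/-- Integer combinations of the `v i`, `i ∈ J`, with coefficients of total size at most `m`. -/
def comboSet {ι : Type} (v : ι → ℝ) (J : Finset ι) (m : ℝ) : Set ℝ :=
  {x | ∃ c : ι → ℤ, ∑ i ∈ J, |(c i : ℝ)| ≤ m ∧ x = ∑ i ∈ J, (c i : ℝ) * v i}

theorem comboSet_mono {ι : Type} (v : ι → ℝ) {J J' : Finset ι} (hJ : J ⊆ J') {m m' : ℝ}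
    (hm : m ≤ m') : comboSet v J m ⊆ comboSet v J' m' := by
  rintro x ⟨c, hc, rfl⟩
  refine ⟨fun i => if i ∈ J then c i else 0, ?_, ?_⟩
  · rw [← Finset.sum_subset hJ]
    · refine le_trans (le_of_eq (Finset.sum_congr rfl fun i hi => ?_)) (hc.trans hm)
      simp [hi]
    · intro i _ hi; simp [hi]
  · rw [← Finset.sum_subset hJ]
    · refine Finset.sum_congr rfl fun i hi => ?_
      simp [hi]
    · intro i _ hi; simp [hi]

theorem comboSet_add {ι : Type} (v : ι → ℝ) {J : Finset ι} {m m' x x' : ℝ}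
    (hx : x ∈ comboSet v J m) (hx' : x' ∈ comboSet v J m') : x + x' ∈ comboSet v J (m + m') := by
  obtain ⟨c, hc, rfl⟩ := hx
  obtain ⟨c', hc', rfl⟩ := hx'
  refine ⟨fun i => c i + c' i, ?_, ?_⟩
  · refine le_trans ?_ (add_le_add hc hc')
    rw [← Finset.sum_add_distrib]
    refine Finset.sum_le_sum fun i _ => ?_
    push_cast; exact abs_add_le _ _
  · rw [← Finset.sum_add_distrib]
    refine Finset.sum_congr rfl fun i _ => ?_
    push_cast; ring

theorem comboSet_neg {ι : Type} (v : ι → ℝ) {J : Finset ι} {m x : ℝ}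
    (hx : x ∈ comboSet v J m) : -x ∈ comboSet v J m := by
  obtain ⟨c, hc, rfl⟩ := hx
  exact ⟨fun i => - c i, by simpa using hc, by simp⟩

theorem mul_mem_comboSet {ι : Type} (v : ι → ℝ) {J : Finset ι} {i : ι} (hi : i ∈ J) (k : ℕ) :
    (k : ℝ) * v i ∈ comboSet v J k := by
  refine ⟨fun j => if j = i then k else 0, ?_, ?_⟩
  · rw [Finset.sum_eq_single i] <;> simp +contextual [hi]
  · rw [Finset.sum_eq_single i] <;> simp +contextual [hi]

/-- Adjoin the torsion elements `y i` to `A` one at a time: either all of them get adjoined with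
`φ` staying injective on a large ball, or at some point a short element of the kernel appears. -/
theorem adjoin_torsion {ι : Type} (v : ι → ℝ) (I : Finset ι) (K M : ℕ) (k' B H : ℝ)
    (hKk : (K : ℝ) ≤ k') (hBK : B < 2 ^ K) (hH : 2 * (K : ℝ) ^ 2 ≤ H)
    (hB : ∀ J ⊆ I, J.card ≤ M → ∀ Y : Finset ℝ, (Y : Set ℝ) ⊆ comboSet v J k' → (Y.card : ℝ) ≤ B)
    {E : Type} [NormedAddCommGroup E] [NormedSpace ℝ E] (A : AddSubgroup E) (φ : E →ₗ[ℝ] ℝ)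
    (J : Finset ι) (hJ : J ⊆ I) (hJM : J.card + K ≤ M) (y : ι → E)
    (hy : ∀ i ∈ I, ‖y i‖ ≤ K ∧ φ (y i) = v i ∧ ∃ s : ℕ, 1 ≤ s ∧ s ≤ K ∧ s • y i ∈ A) :
    ∃ (A' : AddSubgroup E) (J' : Finset ι), A ≤ A' ∧ J ⊆ J' ∧ J' ⊆ I ∧ J'.card ≤ J.card + K ∧
      (∀ a ∈ A', ∃ z, a - z ∈ A ∧ ‖z‖ ≤ K ^ 3 ∧ φ z ∈ comboSet v J' (K ^ 2)) ∧
      ((∃ q ∈ A', q ≠ 0 ∧ ‖q‖ ≤ H ∧ φ q = 0) ∨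
        ((∀ i ∈ I, y i ∈ A') ∧ ∀ q ∈ A', ‖q‖ ≤ H → φ q = 0 → q = 0)) := by
  by_contra hcon
  have key : ∀ l : ℕ, l ≤ K → ∃ (A' : AddSubgroup E) (J' : Finset ι), A ≤ A' ∧ J ⊆ J' ∧
      J' ⊆ I ∧ J'.card ≤ J.card + l ∧
      (∀ a ∈ A', ∃ z, a - z ∈ A ∧ ‖z‖ ≤ l * K ^ 2 ∧ φ z ∈ comboSet v J' (l * K)) ∧
      ∃ T : Finset E, (∀ τ ∈ T, τ ∈ A' ∧ ‖τ‖ ≤ l * K ∧ φ τ ∈ comboSet v J' l) ∧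
        2 ^ l ≤ T.card := by
    intro l
    induction l with
    | zero =>
      intro _
      refine ⟨A, J, le_rfl, subset_rfl, hJ, by simp, ?_, {0}, ?_, by simp⟩
      · intro a ha
        exact ⟨0, by simpa using ha, by simp, fun _ => 0, by simp, by simp⟩
      · intro τ hτ
        rw [Finset.mem_singleton] at hτ
        subst hτ
        exact ⟨A.zero_mem, by simp, fun _ => 0, by simp, by simp⟩
    | succ l ih =>
      intro hl
      obtain ⟨A', J', hA, hJJ, hJI, hcard, hcov, T, hT, hTcard⟩ := ih (by omega)
      have hlK : (l : ℝ) ≤ K := by exact_mod_cast (by omega : l ≤ K)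
      have hnot : ¬ ∀ i ∈ I, y i ∈ A' := by
        intro hall
        refine hcon ⟨A', J', hA, hJJ, hJI, by omega, ?_, ?_⟩
        · intro a ha
          obtain ⟨z, hz, hzn, hzφ⟩ := hcov a ha
          refine ⟨z, hz, hzn.trans ?_, comboSet_mono v subset_rfl ?_ hzφ⟩
          · rw [pow_succ' _ 2]; gcongr
          · rw [sq]; gcongr
        · by_cases hinj : ∃ q ∈ A', q ≠ 0 ∧ ‖q‖ ≤ H ∧ φ q = 0
          · exact Or.inl hinj
          · right
            refine ⟨hall, fun q hq hqH hφ => ?_⟩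
            by_contra hq0
            exact hinj ⟨q, hq, hq0, hqH, hφ⟩
      push Not at hnot
      obtain ⟨i, hi, hiA⟩ := hnot
      obtain ⟨hyn, hyφ, s, hs1, hsK, hsA⟩ := hy i hi
      have hJ' : J' ⊆ insert i J' := Finset.subset_insert _ _
      refine ⟨A' ⊔ AddSubgroup.zmultiples (y i), insert i J', hA.trans le_sup_left,
        hJJ.trans hJ', Finset.insert_subset hi hJI, ?_, ?_, ?_⟩
      · have := Finset.card_insert_le i J'; omega
      · intro a ha
        obtain ⟨a₀, ha₀, b, hb, rfl⟩ := AddSubgroup.mem_sup.1 ha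
        obtain ⟨m, rfl⟩ := AddSubgroup.mem_zmultiples_iff.1 hb
        have hs0 : (0 : ℤ) < s := by exact_mod_cast hs1
        set c : ℕ := (m % s).toNat with hc
        have hc' : (c : ℤ) = m % s := Int.toNat_of_nonneg (Int.emod_nonneg _ hs0.ne')
        have hcs : c ≤ K := by
          have := Int.emod_lt_of_pos m hs0
          omega
        have hm : m • y i = (m / s) • (s • y i) + c • y i := by
          rw [← natCast_zsmul (y i) s, ← natCast_zsmul (y i) c, ← mul_zsmul', ← add_zsmul, hc',
            Int.mul_ediv_add_emod]
        obtain ⟨z, hz, hzn, hzφ⟩ := hcov (a₀ + (m / s) • (s • y i))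
          (A'.add_mem ha₀ (A'.zsmul_mem (hA hsA) _))
        refine ⟨z + c • y i, ?_, ?_, ?_⟩
        · have : a₀ + m • y i - (z + c • y i) = a₀ + (m / s) • (s • y i) - z := by
            rw [hm]; abel
          rw [this]; exact hz
        · have h1 : ‖c • y i‖ ≤ K * K := by
            rw [← Nat.cast_smul_eq_nsmul ℝ, norm_smul, Real.norm_natCast]
            have : (c : ℝ) ≤ K := by exact_mod_cast hcs
            gcongr
          have := norm_add_le z (c • y i)
          push_cast
          nlinarith
        · have h1 : φ (c • y i) ∈ comboSet v (insert i J') K := by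
            rw [map_nsmul, hyφ, nsmul_eq_mul]
            exact comboSet_mono v subset_rfl (by exact_mod_cast hcs)
              (mul_mem_comboSet v (Finset.mem_insert_self i J') c)
          rw [map_add]
          refine comboSet_mono v subset_rfl ?_ (comboSet_add v (comboSet_mono v hJ' le_rfl hzφ) h1)
          push_cast; linarith
      · refine ⟨T ∪ T.image (fun τ => τ + y i), ?_, ?_⟩
        · intro τ hτ
          rcases Finset.mem_union.1 hτ with h | h
          · obtain ⟨h1, h2, h3⟩ := hT τ h
            refine ⟨AddSubgroup.mem_sup_left h1, h2.trans ?_, comboSet_mono v hJ' ?_ h3⟩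
            · push_cast; gcongr; linarith
            · push_cast; linarith
          · obtain ⟨τ, hτT, rfl⟩ := Finset.mem_image.1 h
            obtain ⟨h1, h2, h3⟩ := hT τ hτT
            refine ⟨AddSubgroup.add_mem_sup h1 (AddSubgroup.mem_zmultiples _), ?_, ?_⟩
            · have := norm_add_le τ (y i)
              push_cast; linarith
            · rw [map_add, hyφ]
              have h4 := mul_mem_comboSet v (Finset.mem_insert_self i J') 1
              rw [Nat.cast_one, one_mul] at h4
              push_cast
              exact comboSet_add v (comboSet_mono v hJ' le_rfl h3) h4
        · rw [Finset.card_union_of_disjoint, Finset.card_image_of_injective]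
          · rw [pow_succ]; omega
          · exact add_left_injective _
          · rw [Finset.disjoint_left]
            intro τ h h'
            obtain ⟨τ', h'', rfl⟩ := Finset.mem_image.1 h'
            apply hiA
            have := A'.sub_mem (hT _ h).1 (hT _ h'').1
            simpa using this
  obtain ⟨A', J', hA, hJJ, hJI, hcard, hcov, T, hT, hTcard⟩ := key K le_rfl
  have hinj : ∀ q ∈ A', ‖q‖ ≤ H → φ q = 0 → q = 0 := by
    intro q hq hqH hφ
    by_contra hq0
    refine hcon ⟨A', J', hA, hJJ, hJI, hcard, ?_, Or.inl ⟨q, hq, hq0, hqH, hφ⟩⟩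
    intro a ha
    obtain ⟨z, hz, hzn, hzφ⟩ := hcov a ha
    exact ⟨z, hz, by rw [pow_succ' _ 2]; exact hzn, by rw [sq]; exact hzφ⟩
  have hTinj : Set.InjOn φ T := by
    intro a ha b hb hab
    rw [← sub_eq_zero]
    refine hinj _ (A'.sub_mem (hT a ha).1 (hT b hb).1) ?_ (by rw [map_sub, hab, sub_self])
    have := norm_sub_le a b
    nlinarith [(hT a ha).2.1, (hT b hb).2.1]
  have h1 := hB J' hJI (by omega) (T.image φ) (by
    intro x hx
    obtain ⟨τ, hτ, rfl⟩ := Finset.mem_image.1 (Finset.mem_coe.1 hx)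
    exact comboSet_mono v subset_rfl hKk (hT τ hτ).2.2)
  rw [Finset.card_image_of_injOn hTinj] at h1
  have h2 : ((2 : ℝ) ^ K) ≤ T.card := by exact_mod_cast hTcard
  linarith

/-- Every `v i`, `i ∈ I`, lies in a proper symmetric GAP of rank at most `D` and size at most `B`. -/
def HasProperGAP {ι : Type} (v : ι → ℝ) (I : Finset ι) (D : ℕ) (B : ℝ) : Prop :=
  ∃ (r : ℕ) (g : Fin r → ℝ) (N : Fin r → ℕ), r ≤ D ∧
    (∀ m m' : Fin r → ℤ, (∀ i, |m i| ≤ (N i : ℤ)) → (∀ i, |m' i| ≤ (N i : ℤ)) →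
      (∑ i, (m i : ℝ) * g i) = (∑ i, (m' i : ℝ) * g i) → m = m') ∧
    (∏ i, (2 * (N i : ℝ) + 1)) ≤ B ∧
    ∀ i ∈ I, ∃ m : Fin r → ℤ, (∀ j, |m j| ≤ (N j : ℤ)) ∧ v i = ∑ j, (m j : ℝ) * g j

/-- A finitely generated group mapping to `ℝ` injectively on a large ball yields a GAP. -/
theorem hasProperGAP_of_injOn_ball {ι : Type} (v : ι → ℝ) (I : Finset ι) (K M D : ℕ)
    (k' B H C Γ : ℝ)
    (hC : ∀ (E : Type) [NormedAddCommGroup E] [NormedSpace ℝ E] [FiniteDimensional ℝ E],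
      Module.finrank ℝ E ≤ D → ∀ (Λ : AddSubgroup E) (R : ℝ), 0 ≤ R →
      {x : E | x ∈ Λ ∧ ‖x‖ ≤ 2 ^ D * R}.Finite →
      ∃ (r : ℕ) (u : Fin r → E) (N : Fin r → ℕ), r ≤ D ∧ (∀ i, u i ∈ Λ) ∧
        (∀ m : Fin r → ℤ, (∀ i, |m i| ≤ (N i : ℤ)) → ‖∑ i, m i • u i‖ ≤ C * R) ∧
        (∀ m : Fin r → ℤ, ∑ i, m i • u i = 0 → m = 0) ∧
        (∀ x ∈ Λ, ‖x‖ ≤ R → ∃ m : Fin r → ℤ, (∀ i, |m i| ≤ (N i : ℤ)) ∧ x = ∑ i, m i • u i))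
    (hH1 : 2 * (2 ^ D * (K : ℝ)) ≤ H) (hH2 : 2 * (C * K) ≤ H)
    (hk1 : D * (2 ^ D * K) + Γ ≤ k') (hk2 : D * (C * K) + Γ ≤ k')
    (J : Finset ι) (hJ : J ⊆ I) (hJM : J.card ≤ M)
    (hB : ∀ J ⊆ I, J.card ≤ M → ∀ Y : Finset ℝ, (Y : Set ℝ) ⊆ comboSet v J k' → (Y.card : ℝ) ≤ B)
    {E : Type} [NormedAddCommGroup E] [NormedSpace ℝ E] [FiniteDimensional ℝ E]
    (hE : Module.finrank ℝ E ≤ D) (A : AddSubgroup E) (φ : E →ₗ[ℝ] ℝ)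
    (hA : ∀ a ∈ A, φ a ∈ comboSet v J (D * ‖a‖ + Γ)) (y : ι → E)
    (hy : ∀ i ∈ I, ‖y i‖ ≤ K ∧ φ (y i) = v i ∧ y i ∈ A)
    (hinj : ∀ q ∈ A, ‖q‖ ≤ H → φ q = 0 → q = 0) : HasProperGAP v I D B := by
  have hK : (0 : ℝ) ≤ K := Nat.cast_nonneg K
  have hinj' : ∀ R : ℝ, 2 * R ≤ H → ∀ a ∈ A, ∀ b ∈ A, ‖a‖ ≤ R → ‖b‖ ≤ R → φ a = φ b → a = b := by
    intro R hR a ha b hb han hbn hab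
    rw [← sub_eq_zero]
    refine hinj _ (A.sub_mem ha hb) ?_ (by rw [map_sub, hab, sub_self])
    have := norm_sub_le a b
    linarith
  have hfin : {x : E | x ∈ A ∧ ‖x‖ ≤ 2 ^ D * K}.Finite := by
    refine Set.Finite.of_finite_image (f := φ) ?_ ?_
    · by_contra hinf
      obtain ⟨Y, hY, hYc⟩ := Set.Infinite.exists_subset_card_eq hinf (⌊B⌋₊ + 1)
      have h1 := hB J hJ hJM Y (by
        intro x hx
        obtain ⟨a, ⟨ha, han⟩, rfl⟩ := hY hx
        refine comboSet_mono v subset_rfl (le_trans ?_ hk1) (hA a ha)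
        gcongr)
      rw [hYc] at h1
      push_cast at h1
      linarith [Nat.lt_floor_add_one B]
    · intro a ha b hb hab
      exact hinj' _ hH1 a ha.1 b hb.1 ha.2 hb.2 hab
  obtain ⟨r, u, N, hr, hu, hbox, hind, hcov⟩ := hC E hE A K hK hfin
  have hφ : ∀ m : Fin r → ℤ, φ (∑ i, m i • u i) = ∑ i, (m i : ℝ) * φ (u i) := by
    intro m
    rw [map_sum]
    refine Finset.sum_congr rfl fun i _ => ?_
    rw [map_zsmul, zsmul_eq_mul]
  have hmem : ∀ m : Fin r → ℤ, ∑ i, m i • u i ∈ A := fun m =>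
    A.sum_mem fun i _ => A.zsmul_mem (hu i) _
  have hprop : ∀ m m' : Fin r → ℤ, (∀ i, |m i| ≤ (N i : ℤ)) → (∀ i, |m' i| ≤ (N i : ℤ)) →
      (∑ i, (m i : ℝ) * φ (u i)) = (∑ i, (m' i : ℝ) * φ (u i)) → m = m' := by
    intro m m' hm hm' h
    rw [← hφ, ← hφ] at h
    have h1 := hinj' _ hH2 _ (hmem m) _ (hmem m') (hbox m hm) (hbox m' hm') h
    rw [← sub_eq_zero]
    apply hind
    simp only [Pi.sub_apply, sub_smul, Finset.sum_sub_distrib, h1, sub_self]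
  refine ⟨r, fun i => φ (u i), N, hr, hprop, ?_, ?_⟩
  · set F : Finset (Fin r → ℤ) := Fintype.piFinset fun i => Finset.Icc (-(N i : ℤ)) (N i) with hF
    have hFm : ∀ m ∈ F, ∀ i, |m i| ≤ (N i : ℤ) := by
      intro m hm i
      have := Fintype.mem_piFinset.1 hm i
      rw [Finset.mem_Icc] at this
      exact abs_le.2 this
    have h1 := hB J hJ hJM (F.image fun m => ∑ i, (m i : ℝ) * φ (u i)) (by
      intro x hx
      obtain ⟨m, hm, rfl⟩ := Finset.mem_image.1 (Finset.mem_coe.1 hx)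
      rw [← hφ]
      refine comboSet_mono v subset_rfl (le_trans ?_ hk2) (hA _ (hmem m))
      have := hbox m (hFm m hm)
      gcongr)
    rw [Finset.card_image_of_injOn (fun m hm m' hm' h => hprop m m' (hFm m hm) (hFm m' hm') h),
      hF, Fintype.card_piFinset] at h1
    refine le_trans (le_of_eq ?_) h1
    push_cast
    refine Finset.prod_congr rfl fun i _ => ?_
    rw [Int.card_Icc]
    have : ((N i : ℤ) + 1 - -(N i : ℤ)).toNat = 2 * N i + 1 := by omega
    rw [this]; push_cast; ring
  · intro i hi
    obtain ⟨h1, h2, h3⟩ := hy i hi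
    obtain ⟨m, hm, hmy⟩ := hcov _ h3 h1
    exact ⟨m, hm, by rw [← h2, hmy, hφ]⟩

theorem hasProperGAP_of_torsion {ι : Type} (v : ι → ℝ) (I : Finset ι) (K M D : ℕ)
    (k' B H C : ℝ) (hC1 : 1 ≤ C)
    (hC : ∀ (E : Type) [NormedAddCommGroup E] [NormedSpace ℝ E] [FiniteDimensional ℝ E],
      Module.finrank ℝ E ≤ D → ∀ (Λ : AddSubgroup E) (R : ℝ), 0 ≤ R →
      {x : E | x ∈ Λ ∧ ‖x‖ ≤ 2 ^ D * R}.Finite →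
      ∃ (r : ℕ) (u : Fin r → E) (N : Fin r → ℕ), r ≤ D ∧ (∀ i, u i ∈ Λ) ∧
        (∀ m : Fin r → ℤ, (∀ i, |m i| ≤ (N i : ℤ)) → ‖∑ i, m i • u i‖ ≤ C * R) ∧
        (∀ m : Fin r → ℤ, ∑ i, m i • u i = 0 → m = 0) ∧
        (∀ x ∈ Λ, ‖x‖ ≤ R → ∃ m : Fin r → ℤ, (∀ i, |m i| ≤ (N i : ℤ)) ∧ x = ∑ i, m i • u i))
    (hH0 : 2 * (K : ℝ) ^ 2 ≤ H)
    (hH1 : 2 * (2 ^ D * (K : ℝ)) ≤ H) (hH2 : 2 * (C * K) ≤ H)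
    (hKk : (K : ℝ) ≤ k') (hBK : B < 2 ^ K)
    (hB : ∀ J ⊆ I, J.card ≤ M → ∀ Y : Finset ℝ, (Y : Set ℝ) ⊆ comboSet v J k' → (Y.card : ℝ) ≤ B)
    (t : ℕ) (ht : t ≤ D) :
    ∀ (E : Type) [NormedAddCommGroup E] [NormedSpace ℝ E] [FiniteDimensional ℝ E],
    Module.finrank ℝ E ≤ t → ∀ (A : AddSubgroup E) (φ : E →ₗ[ℝ] ℝ) (Γ : ℝ) (J : Finset ι),
    J ⊆ I → J.card + (t + 1) * K ≤ M →
    Γ + (t + 1) * (D * K ^ 3 + K ^ 2 + D * (1 + H)) + D * (2 ^ D * K) + D * (C * K) ≤ k' →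
    (∀ a ∈ A, φ a ∈ comboSet v J (D * ‖a‖ + Γ)) → ∀ y : ι → E,
    (∀ i ∈ I, ‖y i‖ ≤ K ∧ φ (y i) = v i ∧ ∃ s : ℕ, 1 ≤ s ∧ s ≤ K ∧ s • y i ∈ A) →
    HasProperGAP v I D B := by
  have hK : (0 : ℝ) ≤ K := Nat.cast_nonneg K
  have hH : 0 ≤ H := le_trans (by positivity) hH0
  induction t using Nat.strong_induction_on with
  | _ t ih =>
    intro E _ _ _ hE A φ Γ J hJ hJM hk hA y hy
    obtain ⟨A', J', hAA, hJJ, hJI, hcard, hcov, hor⟩ := adjoin_torsion v I K M k' B H hKk hBK hH0 hB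
      A φ J hJ (by nlinarith) y hy
    have hA' : ∀ a ∈ A', φ a ∈ comboSet v J' (D * ‖a‖ + (Γ + D * K ^ 3 + K ^ 2)) := by
      intro a ha
      obtain ⟨z, hz, hzn, hzφ⟩ := hcov a ha
      have h1 := comboSet_add v (comboSet_mono v hJJ le_rfl (hA _ hz)) hzφ
      rw [← map_add, sub_add_cancel] at h1
      refine comboSet_mono v subset_rfl ?_ h1
      have h2 : D * ‖a - z‖ ≤ D * (‖a‖ + K ^ 3) := by
        have := norm_sub_le a z
        gcongr; linarith
      linarith
    have hend : ((∀ i ∈ I, y i ∈ A') ∧ ∀ q ∈ A', ‖q‖ ≤ H → φ q = 0 → q = 0) →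
        HasProperGAP v I D B := by
      rintro ⟨hyA, hinj⟩
      have e1 : 0 ≤ (D : ℝ) * (1 + H) := by positivity
      have e2 : 0 ≤ (D : ℝ) * (C * K) := by positivity
      have e3 : 0 ≤ (D : ℝ) * (2 ^ D * K) := by positivity
      have e4 : 0 ≤ (t : ℝ) * (D * K ^ 3 + K ^ 2 + D * (1 + H)) := by positivity
      refine hasProperGAP_of_injOn_ball v I K M D k' B H C (Γ + D * K ^ 3 + K ^ 2) hC hH1 hH2
        ?_ ?_ J' hJI (by nlinarith) hB (hE.trans ht) A' φ hA' y
        (fun i hi => ⟨(hy i hi).1, (hy i hi).2.1, hyA i hi⟩) hinj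
      · nlinarith
      · nlinarith
    rcases hor with ⟨q, hq, hq0, hqH, hφq⟩ | h
    swap
    · exact hend h
    obtain _ | t := t
    · have hs : Subsingleton E := Module.finrank_zero_iff.1 (Nat.le_zero.1 hE)
      exact absurd (Subsingleton.elim q 0) hq0
    · set W := Submodule.span ℝ {q} with hW
      have : IsClosed (W : Set E) := W.closed_of_finiteDimensional
      have hWφ : W ≤ LinearMap.ker φ := by
        rw [hW, Submodule.span_singleton_le_iff_mem]; exact hφq
      refine ih t (by omega) (by omega) (E ⧸ W) (finrank_quotient_span_singleton_le hE hq0)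
        (A'.map W.mkQ.toAddMonoidHom) (W.liftQ φ hWφ)
        (Γ + (D * K ^ 3 + K ^ 2 + D * (1 + H))) J' hJI (by nlinarith) ?_ ?_
        (fun i => Submodule.Quotient.mk (y i)) ?_
      · push_cast at hk; linarith
      · rintro _ ⟨a, ha, rfl⟩
        obtain ⟨b, hb, ⟨k, hbk⟩, hbn⟩ := exists_lift_norm_le A' q hq a ha one_pos
        have h1 : W.liftQ φ hWφ (W.mkQ.toAddMonoidHom a) = φ b := by
          rw [hbk, map_add, map_zsmul, hφq, smul_zero, add_zero]
          exact W.liftQ_apply φ a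
        rw [h1]
        refine comboSet_mono v subset_rfl ?_ (hA' b hb)
        have h2 : D * ‖b‖ ≤ D * (‖(Submodule.Quotient.mk a : E ⧸ W)‖ + (1 + H)) := by
          gcongr; linarith
        have h3 : ‖W.mkQ.toAddMonoidHom a‖ = ‖(Submodule.Quotient.mk a : E ⧸ W)‖ := rfl
        rw [h3]
        linarith
      · intro i hi
        obtain ⟨h1, h2, s, hs1, hsK, hsA⟩ := hy i hi
        refine ⟨(Submodule.Quotient.norm_mk_le W _).trans h1, ?_, s, hs1, hsK, ?_⟩
        · rw [← h2]; exact W.liftQ_apply φ _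
        · exact ⟨s • y i, hAA hsA, map_nsmul W.mkQ s (y i)⟩

/-- No nontrivial integer relation with coefficients at most `K` holds between the `v i`,
`i ∈ J`. -/
def IsDissociated {ι : Type} (v : ι → ℝ) (K : ℕ) (J : Finset ι) : Prop :=
  ∀ c : ι → ℤ, (∀ i ∈ J, |c i| ≤ K) → ∑ i ∈ J, (c i : ℝ) * v i = 0 → ∀ i ∈ J, c i = 0

theorem IsDissociated.subset {ι : Type} {v : ι → ℝ} {K : ℕ} {J J' : Finset ι}
    (h : IsDissociated v K J) (hJ : J' ⊆ J) : IsDissociated v K J' := by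
  intro c hc hsum i hi
  have := h (fun i => if i ∈ J' then c i else 0) (fun i _ => ?_) ?_ i (hJ hi)
  · simpa [hi] using this
  · by_cases hi : i ∈ J'
    · simpa [hi] using hc i hi
    · simp [hi]
  · rw [← hsum, ← Finset.sum_subset hJ]
    · exact Finset.sum_congr rfl fun i hi => by simp [hi]
    · intro i _ hi; simp [hi]

/-- A dissociated set has many distinct subset sums. -/
theorem IsDissociated.exists_finset {ι : Type} {v : ι → ℝ} {K : ℕ} {J : Finset ι}
    (h : IsDissociated v K J) :
    ∃ Y : Finset ℝ, (Y : Set ℝ) ⊆ comboSet v J (J.card * K) ∧ Y.card = (K + 1) ^ J.card := by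
  refine ⟨Finset.univ.image fun f : J → Fin (K + 1) => ∑ j, ((f j : ℕ) : ℝ) * v j, ?_, ?_⟩
  · intro x hx
    obtain ⟨f, -, rfl⟩ := Finset.mem_image.1 (Finset.mem_coe.1 hx)
    refine ⟨fun i => if hi : i ∈ J then ((f ⟨i, hi⟩ : ℕ) : ℤ) else 0, ?_, ?_⟩
    · rw [← nsmul_eq_mul]
      refine Finset.sum_le_card_nsmul _ _ _ fun i hi => ?_
      have := (f ⟨i, hi⟩).is_le
      simp only [hi, dif_pos]
      rw [Int.cast_natCast, Nat.abs_cast]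
      exact_mod_cast this
    · rw [← Finset.sum_coe_sort J]
      refine Finset.sum_congr rfl fun i _ => ?_
      simp
  · rw [Finset.card_image_of_injective]
    · simp
    · intro f f' hff
      have h0 := h (fun i => if hi : i ∈ J then ((f ⟨i, hi⟩ : ℕ) : ℤ) - ((f' ⟨i, hi⟩ : ℕ) : ℤ)
        else 0) (fun i hi => ?_) ?_
      · ext j
        have := h0 j j.2
        simp only [j.2, dif_pos, Subtype.coe_eta] at this
        omega
      · simp only [hi, dif_pos]
        have := (f ⟨i, hi⟩).is_le
        have := (f' ⟨i, hi⟩).is_le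
        rw [abs_le]
        constructor <;> omega
      · rw [← Finset.sum_coe_sort J]
        have hff : ∑ j, ((f j : ℕ) : ℝ) * v j = ∑ j, ((f' j : ℕ) : ℝ) * v j := hff
        rw [← sub_eq_zero.2 hff, ← Finset.sum_sub_distrib]
        refine Finset.sum_congr rfl fun i _ => ?_
        simp only [i.2, dif_pos]
        push_cast
        ring

theorem IsDissociated.exists_mul_eq {ι : Type} {v : ι → ℝ} {K : ℕ} (hK : 1 ≤ K) {I J : Finset ι}
    (h : IsDissociated v K J) (hmax : ∀ J' ⊆ I, IsDissociated v K J' → J'.card ≤ J.card)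
    (hJI : J ⊆ I) {i : ι} (hi : i ∈ I) :
    ∃ (s : ℕ) (a : ι → ℤ), 1 ≤ s ∧ s ≤ K ∧ (∀ j ∈ J, |a j| ≤ K) ∧
      (s : ℝ) * v i = ∑ j ∈ J, (a j : ℝ) * v j := by
  by_cases hiJ : i ∈ J
  · refine ⟨1, fun j => if j = i then 1 else 0, le_rfl, hK, ?_, ?_⟩
    · intro j _
      by_cases hj : j = i
      · simpa [hj] using hK
      · simp [hj]
    · rw [Finset.sum_eq_single i] <;> simp +contextual [hiJ]
  have hnot : ¬ IsDissociated v K (insert i J) := by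
    intro hd
    have := hmax _ (Finset.insert_subset hi hJI) hd
    rw [Finset.card_insert_of_notMem hiJ] at this
    omega
  unfold IsDissociated at hnot
  push Not at hnot
  obtain ⟨c, hc, hsum, j, hj, hcj⟩ := hnot
  rw [Finset.sum_insert hiJ] at hsum
  have hci : c i ≠ 0 := by
    intro hci
    rw [hci, Int.cast_zero, zero_mul, zero_add] at hsum
    have h0 := h c (fun k hk => hc k (Finset.mem_insert_of_mem hk)) hsum
    rcases Finset.mem_insert.1 hj with rfl | hj
    · exact hcj hci
    · exact hcj (h0 j hj)
  have hcK := hc i (Finset.mem_insert_self _ _)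
  have habs : ((c i).natAbs : ℤ) = |c i| := Int.natCast_natAbs _
  rcases lt_or_gt_of_ne hci with hneg | hpos
  · refine ⟨(c i).natAbs, c, by omega, by omega,
      fun k hk => hc k (Finset.mem_insert_of_mem hk), ?_⟩
    have : (((c i).natAbs : ℕ) : ℝ) = -(c i : ℝ) := by
      rw [Nat.cast_natAbs, abs_of_neg hneg, Int.cast_neg]
    rw [this]; linarith
  · refine ⟨(c i).natAbs, fun k => - c k, by omega, by omega,
      fun k hk => by simpa using hc k (Finset.mem_insert_of_mem hk), ?_⟩
    have : (((c i).natAbs : ℕ) : ℝ) = (c i : ℝ) := by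
      rw [Nat.cast_natAbs, abs_of_pos hpos]
    rw [this]
    simp only [Int.cast_neg, neg_mul, Finset.sum_neg_distrib]
    linarith

/-- If no small set of the `v i` generates more than `B` short integer combinations, then all the
`v i` lie in a proper symmetric GAP of bounded rank and size at most `B`. -/
theorem hasProperGAP_of_card_le (D : ℕ) : ∃ K₀ : ℕ, ∀ K : ℕ, K₀ ≤ K → ∀ (ι : Type) (v : ι → ℝ)
    (I : Finset ι) (B : ℝ), B < 2 ^ K → B < ((K : ℝ) + 1) ^ (D + 1) →
    (∀ J ⊆ I, J.card ≤ K ^ 2 → ∀ Y : Finset ℝ, (Y : Set ℝ) ⊆ comboSet v J ((K : ℝ) ^ 4) →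
      (Y.card : ℝ) ≤ B) → HasProperGAP v I D B := by
  obtain ⟨C, hC1, hC⟩ := exists_gap_of_discrete D
  refine ⟨⌈(D + 1) * (3 * D + 1) + D * 2 ^ D + D * C + 2 * 2 ^ D + 2 * C + 2 * D + 2⌉₊, ?_⟩
  intro K hK₀ ι v I B hB2 hBD hB
  have hKR : (D + 1) * (3 * D + 1) + D * 2 ^ D + D * C + 2 * 2 ^ D + 2 * C + 2 * D + 2 ≤ (K : ℝ) :=
    Nat.ceil_le.1 hK₀
  have hD0 : (0 : ℝ) ≤ D := Nat.cast_nonneg D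
  have h2D : (1 : ℝ) ≤ 2 ^ D := one_le_pow₀ (by norm_num)
  have hDC : 0 ≤ (D : ℝ) * C := by positivity
  have hD2 : 0 ≤ (D : ℝ) * 2 ^ D := by positivity
  have hDD : 0 ≤ ((D : ℝ) + 1) * (3 * D + 1) := by positivity
  have hK2D : 2 * (D : ℝ) + 2 ≤ K := by linarith
  have hK1 : (1 : ℝ) ≤ K := by linarith
  have hK1' : 1 ≤ K := by exact_mod_cast hK1
  have hK2D' : 2 * D + 2 ≤ K := by exact_mod_cast hK2D
  have hKsq : (K : ℝ) ≤ K ^ 2 := le_self_pow₀ hK1 (by norm_num)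
  have hKcu : (K : ℝ) ^ 2 ≤ K ^ 3 := pow_le_pow_right₀ hK1 (by norm_num)
  have hcard : ∀ J ⊆ I, IsDissociated v K J → J.card ≤ D := by
    intro J hJ hd
    by_contra! hlt
    obtain ⟨J', hJ', hJ'c⟩ := Finset.exists_subset_card_eq (Nat.succ_le_of_lt hlt)
    obtain ⟨Y, hY, hYc⟩ := (hd.subset hJ').exists_finset
    have := hB J' (hJ'.trans hJ) (by rw [hJ'c]; nlinarith) Y
      (hY.trans (comboSet_mono v subset_rfl ?_))
    · rw [hYc, hJ'c] at this
      push_cast at this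
      exact absurd hBD (not_lt.2 this)
    · rw [hJ'c]
      push_cast
      calc ((D : ℝ) + 1) * K ≤ K * K := by gcongr; linarith
        _ ≤ K ^ 4 := by
          rw [← sq]; exact pow_le_pow_right₀ hK1 (by norm_num)
  obtain ⟨J, hJ, hmax⟩ := Finset.exists_max_image (I.powerset.filter (IsDissociated v K))
    Finset.card ⟨∅, by simp [IsDissociated]⟩
  rw [Finset.mem_filter, Finset.mem_powerset] at hJ
  obtain ⟨hJI, hJd⟩ := hJ
  have hmax' : ∀ J' ⊆ I, IsDissociated v K J' → J'.card ≤ J.card := fun J' h1 h2 =>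
    hmax J' (by simp [h1, h2])
  have hrep : ∀ i : ι, ∃ (s : ℕ) (a : ι → ℤ), i ∈ I → 1 ≤ s ∧ s ≤ K ∧ (∀ j ∈ J, |a j| ≤ K) ∧
      (s : ℝ) * v i = ∑ j ∈ J, (a j : ℝ) * v j := by
    intro i
    by_cases hi : i ∈ I
    · obtain ⟨s, a, h⟩ := hJd.exists_mul_eq hK1' hmax' hJI hi
      exact ⟨s, a, fun _ => h⟩
    · exact ⟨0, 0, fun h => absurd h hi⟩
  choose s a hsa using hrep
  let A : AddSubgroup (J → ℝ) :=
    (AddMonoidHom.pi fun j : J => (Int.castAddHom ℝ).comp (Pi.evalAddMonoidHom _ j)).range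
  have hA : ∀ x : J → ℝ, x ∈ A ↔ ∃ c : J → ℤ, ∀ j, x j = c j := by
    intro x
    constructor
    · rintro ⟨c, rfl⟩
      exact ⟨c, fun j => rfl⟩
    · rintro ⟨c, hc⟩
      exact ⟨c, funext fun j => (hc j).symm⟩
  let φ : (J → ℝ) →ₗ[ℝ] ℝ := ∑ j : J, (v j) • LinearMap.proj j
  have hφ : ∀ x, φ x = ∑ j : J, x j * v j := by
    intro x
    simp only [φ, LinearMap.sum_apply, LinearMap.smul_apply, LinearMap.proj_apply, smul_eq_mul]
    exact Finset.sum_congr rfl fun j _ => mul_comm _ _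
  have hJD : J.card ≤ D := hcard J hJI hJd
  have hJDR : (J.card : ℝ) ≤ D := by exact_mod_cast hJD
  refine hasProperGAP_of_torsion v I K (K ^ 2) D ((K : ℝ) ^ 4) B ((K : ℝ) ^ 3) C hC1 hC
    ?_ ?_ ?_ (le_self_pow₀ hK1 (by norm_num)) hB2 hB D le_rfl (J → ℝ) ?_ A φ 0 J hJI ?_ ?_ ?_
    (fun i j => (a i j : ℝ) / s i) ?_
  · rw [pow_succ' _ 2]; gcongr; linarith
  · calc 2 * (2 ^ D * (K : ℝ)) = (2 * 2 ^ D) * K := by ring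
      _ ≤ K * K := by gcongr; linarith
      _ ≤ K ^ 3 := by rw [← sq]; exact hKcu
  · calc 2 * (C * (K : ℝ)) = (2 * C) * K := by ring
      _ ≤ K * K := by gcongr; nlinarith
      _ ≤ K ^ 3 := by rw [← sq]; exact hKcu
  · simpa using hJD
  · nlinarith
  · have h1K : (1 : ℝ) ≤ K ^ 3 := one_le_pow₀ hK1
    have hKK : (K : ℝ) ≤ K ^ 3 := hKsq.trans hKcu
    calc 0 + ((D : ℝ) + 1) * (D * K ^ 3 + K ^ 2 + D * (1 + K ^ 3)) + D * (2 ^ D * K) + D * (C * K)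
        ≤ 0 + ((D : ℝ) + 1) * (D * K ^ 3 + K ^ 3 + D * (K ^ 3 + K ^ 3)) + D * (2 ^ D * K ^ 3)
          + D * (C * K ^ 3) := by gcongr
      _ = ((D + 1) * (3 * D + 1) + D * 2 ^ D + D * C) * K ^ 3 := by ring
      _ ≤ K * K ^ 3 := by gcongr; linarith
      _ = K ^ 4 := by ring
  · intro x hx
    obtain ⟨c, hc⟩ := (hA x).1 hx
    refine ⟨fun i => if hi : i ∈ J then c ⟨i, hi⟩ else 0, ?_, ?_⟩
    · rw [← Finset.sum_coe_sort J]
      calc ∑ j : J, |((if hi : (j : ι) ∈ J then c ⟨j, hi⟩ else 0 : ℤ) : ℝ)|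
          ≤ ∑ j : J, ‖x‖ := Finset.sum_le_sum fun j _ => by
            simp only [j.2, dif_pos]
            rw [← hc j, ← Real.norm_eq_abs]
            exact norm_le_pi_norm x j
        _ = J.card * ‖x‖ := by simp
        _ ≤ D * ‖x‖ + 0 := by rw [add_zero]; gcongr
    · rw [hφ, ← Finset.sum_coe_sort J]
      refine Finset.sum_congr rfl fun j _ => ?_
      simp [hc j]
  · intro i hi
    obtain ⟨hs1, hsK, ha, hsum⟩ := hsa i hi
    have hsR : (1 : ℝ) ≤ s i := by exact_mod_cast hs1
    refine ⟨?_, ?_, s i, hs1, hsK, ?_⟩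
    · refine (pi_norm_le_iff_of_nonneg (by positivity)).2 fun j => ?_
      rw [Real.norm_eq_abs, abs_div, abs_of_pos (by linarith : (0 : ℝ) < s i)]
      have : |(a i j : ℝ)| ≤ K := by exact_mod_cast ha j j.2
      exact (div_le_self (abs_nonneg _) hsR).trans this
    · rw [hφ]
      have h0 : (s i : ℝ) ≠ 0 := by positivity
      apply mul_left_cancel₀ h0
      rw [hsum, ← Finset.sum_coe_sort J, Finset.mul_sum]
      refine Finset.sum_congr rfl fun j _ => ?_
      field_simp
    · rw [hA]
      refine ⟨fun j => a i j, fun j => ?_⟩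
      have h0 : (s i : ℝ) ≠ 0 := by positivity
      simp only [Pi.smul_apply, nsmul_eq_mul]
      field_simp

/-- `f` is continuous and its average over `[0, T]` tends to `c` as `T → ∞`. -/
def HasMean (f : ℝ → ℝ) (c : ℝ) : Prop :=
  Continuous f ∧ Filter.Tendsto (fun T : ℝ => (∫ x in (0 : ℝ)..T, f x) / T) Filter.atTop (nhds c)

theorem HasMean.const_mul {f : ℝ → ℝ} {c : ℝ} (h : HasMean f c) (k : ℝ) :
    HasMean (fun x => k * f x) (k * c) := by
  refine ⟨continuous_const.mul h.1, ?_⟩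
  refine (h.2.const_mul k).congr fun T => ?_
  rw [intervalIntegral.integral_const_mul, mul_div_assoc]

theorem HasMean.add {f g : ℝ → ℝ} {c d : ℝ} (hf : HasMean f c) (hg : HasMean g d) :
    HasMean (fun x => f x + g x) (c + d) := by
  refine ⟨hf.1.add hg.1, ?_⟩
  refine (hf.2.add hg.2).congr fun T => ?_
  rw [intervalIntegral.integral_add (hf.1.intervalIntegrable _ _) (hg.1.intervalIntegrable _ _),
    add_div]

theorem hasMean_cos (s : ℝ) : HasMean (fun x => Real.cos (s * x)) (if s = 0 then 1 else 0) := by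
  refine ⟨by fun_prop, ?_⟩
  split_ifs with hs
  · subst hs
    refine Filter.Tendsto.congr' ?_ tendsto_const_nhds
    filter_upwards [Filter.eventually_gt_atTop 0] with T hT
    simp [hT.ne']
  · have hzer : ∀ T : ℝ, ∫ x in (0 : ℝ)..T, Real.cos (s * x) = Real.sin (s * T) / s := by
      intro T
      rw [intervalIntegral.integral_comp_mul_left (fun x => Real.cos x) hs, integral_cos]
      simp [div_eq_inv_mul]
    have h0 : Filter.Tendsto (fun T : ℝ => |s|⁻¹ / T) Filter.atTop (nhds 0) :=
      Filter.Tendsto.div_atTop tendsto_const_nhds Filter.tendsto_id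
    refine squeeze_zero_norm' ?_ h0
    filter_upwards [Filter.eventually_gt_atTop 0] with T hT
    rw [hzer, norm_div, norm_div, Real.norm_eq_abs, Real.norm_eq_abs, Real.norm_eq_abs,
      abs_of_pos hT, div_eq_mul_inv _ |s|]
    gcongr
    exact mul_le_of_le_one_left (by positivity) (Real.abs_sin_le_one _)

theorem hasMean_const (c : ℝ) : HasMean (fun _ => c) c := by
  simpa using (hasMean_cos 0).const_mul c

theorem HasMean.sum {κ : Type} (S : Finset κ) {f : κ → ℝ → ℝ} {c : κ → ℝ}
    (h : ∀ i ∈ S, HasMean (f i) (c i)) : HasMean (fun x => ∑ i ∈ S, f i x) (∑ i ∈ S, c i) := by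
  induction S using Finset.induction_on with
  | empty => simpa using hasMean_const 0
  | insert i S hi ih =>
    simp only [Finset.sum_insert hi]
    exact (h i (Finset.mem_insert_self _ _)).add
      (ih fun j hj => h j (Finset.mem_insert_of_mem hj))

theorem HasMean.mono {f g : ℝ → ℝ} {c d : ℝ} (hf : HasMean f c) (hg : HasMean g d)
    (hfg : ∀ x, f x ≤ g x) : c ≤ d := by
  refine le_of_tendsto_of_tendsto hf.2 hg.2 ?_
  filter_upwards [Filter.eventually_gt_atTop 0] with T hT
  gcongr
  exact intervalIntegral.integral_mono_on hT.le (hf.1.intervalIntegrable _ _)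
    (hg.1.intervalIntegrable _ _) fun x _ => hfg x

theorem abs_sin_add_le (a b : ℝ) : |Real.sin (a + b)| ≤ |Real.sin a| + |Real.sin b| := by
  rw [Real.sin_add]
  refine (abs_add_le _ _).trans ?_
  rw [abs_mul, abs_mul]
  exact add_le_add (mul_le_of_le_one_right (abs_nonneg _) (Real.abs_cos_le_one _))
    (mul_le_of_le_one_left (abs_nonneg _) (Real.abs_cos_le_one _))

theorem abs_sin_nat_mul_le (n : ℕ) (x : ℝ) : |Real.sin (n * x)| ≤ n * |Real.sin x| := by
  induction n with
  | zero => simp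
  | succ n ih =>
    push_cast
    rw [add_mul, one_mul, add_mul, one_mul]
    exact (abs_sin_add_le _ _).trans (by linarith)

theorem abs_sin_int_mul_le (n : ℤ) (x : ℝ) : |Real.sin (n * x)| ≤ |(n : ℝ)| * |Real.sin x| := by
  have h := abs_sin_nat_mul_le n.natAbs x
  rw [Nat.cast_natAbs, Int.cast_abs] at h
  rcases abs_choice (n : ℝ) with h' | h' <;> rw [h'] at h ⊢
  · exact h
  · rwa [neg_mul, Real.sin_neg, abs_neg] at h

theorem sin_sq_le_of_mem_comboSet {ι : Type} (v : ι → ℝ) {J : Finset ι} {m x : ℝ}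
    (hx : x ∈ comboSet v J m) (ξ : ℝ) :
    Real.sin (x * ξ) ^ 2 ≤ m ^ 2 * ∑ i ∈ J, Real.sin (v i * ξ) ^ 2 := by
  obtain ⟨c, hc, rfl⟩ := hx
  set s := ∑ i ∈ J, Real.sin (v i * ξ) ^ 2 with hs
  have hs0 : 0 ≤ s := Finset.sum_nonneg fun i _ => sq_nonneg _
  have hsum : ∀ S ⊆ J, |Real.sin ((∑ i ∈ S, (c i : ℝ) * v i) * ξ)| ≤
      ∑ i ∈ S, |(c i : ℝ)| * √s := by
    intro S
    induction S using Finset.induction_on with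
    | empty => simp
    | insert i S hi ih =>
      intro hSJ
      rw [Finset.sum_insert hi, Finset.sum_insert hi, add_mul, mul_assoc]
      refine (abs_sin_add_le _ _).trans (add_le_add ((abs_sin_int_mul_le _ _).trans ?_)
        (ih ((Finset.subset_insert _ _).trans hSJ)))
      gcongr
      refine Real.abs_le_sqrt ?_
      exact Finset.single_le_sum (f := fun i => Real.sin (v i * ξ) ^ 2)
        (fun i _ => sq_nonneg _) (hSJ (Finset.mem_insert_self _ _))
  have h := hsum J subset_rfl
  rw [← Finset.sum_mul] at h
  have h' := h.trans (mul_le_mul_of_nonneg_right hc (Real.sqrt_nonneg s))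
  rw [← sq_abs]
  refine (pow_le_pow_left₀ (abs_nonneg _) h' 2).trans ?_
  rw [mul_pow, Real.sq_sqrt hs0]

/-- The Fejér-type kernel attached to a finite set of frequencies. -/
def fejer (Y : Finset ℝ) (ξ : ℝ) : ℝ :=
  ((Y.card : ℝ) ^ 2)⁻¹ * ∑ y ∈ Y, ∑ y' ∈ Y, Real.cos (2 * (y - y') * ξ)

theorem fejer_nonneg (Y : Finset ℝ) (ξ : ℝ) : 0 ≤ fejer Y ξ := by
  refine mul_nonneg (by positivity) ?_
  have : ∑ y ∈ Y, ∑ y' ∈ Y, Real.cos (2 * (y - y') * ξ) =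
      (∑ y ∈ Y, Real.cos (2 * y * ξ)) ^ 2 + (∑ y ∈ Y, Real.sin (2 * y * ξ)) ^ 2 := by
    rw [sq, sq, Finset.sum_mul_sum, Finset.sum_mul_sum, ← Finset.sum_add_distrib]
    refine Finset.sum_congr rfl fun y _ => ?_
    rw [← Finset.sum_add_distrib]
    refine Finset.sum_congr rfl fun y' _ => ?_
    rw [← Real.cos_sub]
    ring_nf
  rw [this]
  positivity

theorem hasMean_fejer {Y : Finset ℝ} (hY : Y.Nonempty) : HasMean (fejer Y) (1 / Y.card) := by
  have h := (HasMean.sum Y fun y _ => HasMean.sum Y fun y' _ =>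
    hasMean_cos (2 * (y - y'))).const_mul ((Y.card : ℝ) ^ 2)⁻¹
  have hc : (0 : ℝ) < Y.card := by exact_mod_cast hY.card_pos
  have heq : ((Y.card : ℝ) ^ 2)⁻¹ * ∑ y ∈ Y, ∑ y' ∈ Y, (if 2 * (y - y') = 0 then (1 : ℝ) else 0) =
      1 / Y.card := by
    have : ∀ y ∈ Y, ∑ y' ∈ Y, (if 2 * (y - y') = 0 then (1 : ℝ) else 0) = 1 := by
      intro y hy
      rw [Finset.sum_eq_single y]
      · simp
      · intro y' _ hne
        rw [if_neg]
        simpa [sub_eq_zero] using hne.symm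
      · exact fun h => absurd hy h
    rw [Finset.sum_congr rfl this]
    simp
    field_simp
  rw [heq] at h
  exact h

theorem one_sub_le_fejer {ι : Type} (v : ι → ℝ) {J : Finset ι} {k : ℝ} {Y : Finset ℝ}
    (hne : Y.Nonempty) (hY : (Y : Set ℝ) ⊆ comboSet v J k) (ξ : ℝ) :
    1 - 8 * k ^ 2 * ∑ i ∈ J, Real.sin (v i * ξ) ^ 2 ≤ fejer Y ξ := by
  have hc : (0 : ℝ) < Y.card := by exact_mod_cast hne.card_pos
  set b := 1 - 8 * k ^ 2 * ∑ i ∈ J, Real.sin (v i * ξ) ^ 2 with hb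
  have hbd : ∀ y ∈ Y, ∀ y' ∈ Y, b ≤ Real.cos (2 * (y - y') * ξ) := by
    intro y hy y' hy'
    have hm := comboSet_add v (hY hy) (comboSet_neg v (hY hy'))
    have := sin_sq_le_of_mem_comboSet v hm ξ
    rw [← sub_eq_add_neg] at this
    rw [show 2 * (y - y') * ξ = 2 * ((y - y') * ξ) by ring, Real.cos_two_mul, Real.cos_sq']
    rw [hb]
    nlinarith
  have h1 : ∑ y ∈ Y, ∑ y' ∈ Y, b ≤ ∑ y ∈ Y, ∑ y' ∈ Y, Real.cos (2 * (y - y') * ξ) :=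
    Finset.sum_le_sum fun y hy => Finset.sum_le_sum fun y' hy' => hbd y hy y' hy'
  simp only [Finset.sum_const, nsmul_eq_mul] at h1
  unfold fejer
  rw [← div_eq_inv_mul, le_div_iff₀ (by positivity)]
  linarith

theorem exp_le_fejer_add {ι : Type} (v : ι → ℝ) {J : Finset ι} {k l : ℝ} (hk : 1 ≤ k)
    (hl : 32 * k ^ 2 ≤ l) {Y : Finset ℝ}
    (hne : Y.Nonempty) (hY : (Y : Set ℝ) ⊆ comboSet v J k) (ξ : ℝ) :
    Real.exp (-(l / 2 * ∑ i ∈ J, Real.sin (v i * ξ) ^ 2)) ≤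
      fejer Y ξ + Real.exp (-(l / (32 * k ^ 2))) := by
  have h1 := one_sub_le_fejer v hne hY ξ
  have h0 := fejer_nonneg Y ξ
  set s := ∑ i ∈ J, Real.sin (v i * ξ) ^ 2 with hs
  have hs0 : 0 ≤ s := Finset.sum_nonneg fun i _ => sq_nonneg _
  have hk2 : 0 < k ^ 2 := by positivity
  rcases le_or_gt (8 * k ^ 2 * s) (1 / 2) with hb | hb
  · set b := 8 * k ^ 2 * s with hbdef
    have hb0 : 0 ≤ b := by positivity
    have h2 : 2 * b ≤ l / 2 * s := by rw [hbdef]; nlinarith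
    have h3 : Real.exp (-(l / 2 * s)) ≤ 1 - b := by
      calc Real.exp (-(l / 2 * s)) ≤ Real.exp (-(2 * b)) := Real.exp_le_exp.2 (by linarith)
        _ = (Real.exp (2 * b))⁻¹ := Real.exp_neg _
        _ ≤ (1 + 2 * b)⁻¹ := by
          gcongr
          linarith [Real.add_one_le_exp (2 * b)]
        _ ≤ 1 - b := by
          rw [inv_le_iff_one_le_mul₀ (by positivity)]
          nlinarith
    linarith [Real.exp_pos (-(l / (32 * k ^ 2)))]
  · have h2 : Real.exp (-(l / 2 * s)) ≤ Real.exp (-(l / (32 * k ^ 2))) := by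
      apply Real.exp_le_exp.2
      rw [neg_le_neg_iff, div_le_iff₀ (by positivity)]
      have : 0 < l := by nlinarith
      nlinarith
    linarith

/-- The characteristic function of a lazy sign is small unless the phase is close to a multiple
of `π`. -/
theorem abs_charFun_le {μ : ℝ} (hμ0 : 0 < μ) (hμ1 : μ ≤ 1) (θ : ℝ) :
    |1 - μ + μ * Real.cos θ| ≤ Real.exp (-(μ / 2 * Real.sin θ ^ 2)) := by
  have h1 := Real.cos_le_one θ
  have h2 := Real.neg_one_le_cos θ
  have h3 := Real.sin_sq θ
  have h4 := Real.add_one_le_exp (-(μ / 2 * Real.sin θ ^ 2))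
  refine le_trans ?_ h4
  rw [h3, abs_le]
  constructor <;> nlinarith [mul_nonneg (sub_nonneg.2 h1) (sub_nonneg.2 h1),
    mul_nonneg (sub_nonneg.2 h1) (by linarith : 0 ≤ 1 + Real.cos θ),
    mul_nonneg hμ0.le (mul_nonneg (sub_nonneg.2 h1) (sub_nonneg.2 h1)),
    mul_nonneg hμ0.le (by linarith : 0 ≤ 1 + Real.cos θ),
    mul_nonneg hμ0.le (mul_nonneg (by linarith : 0 ≤ 1 + Real.cos θ)
      (by linarith : 0 ≤ 1 + Real.cos θ))]

theorem sum_cos_le {μ : ℝ} (hμ0 : 0 < μ) (hμ1 : μ ≤ 1) {ι : Type} [Fintype ι] (v : ι → ℝ)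
    (a ξ : ℝ) :
    ∑ s : ι → Fin 3, (∏ i, etaW μ (s i)) * Real.cos ((∑ i, v i * etaV (s i) - a) * ξ) ≤
      Real.exp (-(μ / 2 * ∑ i, Real.sin (v i * ξ) ^ 2)) := by
  have hre : ∀ s : ι → Fin 3,
      (∏ i, etaW μ (s i)) * Real.cos ((∑ i, v i * etaV (s i) - a) * ξ) =
        (Complex.exp (((-(a * ξ) : ℝ) : ℂ) * Complex.I) *
          ∏ i, ((etaW μ (s i) : ℝ) : ℂ) *
            Complex.exp (((v i * etaV (s i) * ξ : ℝ) : ℂ) * Complex.I)).re := by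
    intro s
    rw [Finset.prod_mul_distrib, ← Complex.exp_sum, mul_left_comm, ← Complex.exp_add,
      ← Complex.ofReal_prod, Complex.re_ofReal_mul, ← Finset.sum_mul, ← add_mul,
      ← Complex.ofReal_sum, ← Complex.ofReal_add, Complex.exp_ofReal_mul_I_re, sub_mul,
      Finset.sum_mul]
    congr 2
    ring
  rw [Finset.sum_congr rfl fun s _ => hre s, ← Complex.re_sum, ← Finset.mul_sum]
  have hprod := Finset.prod_univ_sum (fun _ : ι => (Finset.univ : Finset (Fin 3)))
    (fun i k => ((etaW μ k : ℝ) : ℂ) * Complex.exp (((v i * etaV k * ξ : ℝ) : ℂ) * Complex.I))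
  rw [Fintype.piFinset_univ] at hprod
  rw [← hprod]
  refine (Complex.re_le_norm _).trans ?_
  rw [norm_mul, Complex.norm_exp_ofReal_mul_I, one_mul, norm_prod, Finset.mul_sum,
    ← Finset.sum_neg_distrib, Real.exp_sum]
  refine Finset.prod_le_prod (fun i _ => norm_nonneg _) fun i _ => ?_
  have hphi : ∑ k : Fin 3, ((etaW μ k : ℝ) : ℂ) *
      Complex.exp (((v i * etaV k * ξ : ℝ) : ℂ) * Complex.I) =
      ((1 - μ + μ * Real.cos (v i * ξ) : ℝ) : ℂ) := by
    simp only [Fin.sum_univ_three, etaW, etaV, Matrix.cons_val_zero, Matrix.cons_val_one,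
      Matrix.cons_val]
    rw [show v i * 1 * ξ = v i * ξ by ring, show v i * -1 * ξ = -(v i * ξ) by ring,
      Complex.exp_ofReal_mul_I, Complex.exp_ofReal_mul_I, Real.cos_neg, Real.sin_neg]
    push_cast
    simp
    ring
  rw [hphi, Complex.norm_real, Real.norm_eq_abs]
  exact abs_charFun_le hμ0 hμ1 _

/-- A Halász-type inequality: if there are many disjoint index sets, each generating many short
integer combinations, then a random sum has small concentration. -/
theorem probEta_le {μ : ℝ} (hμ0 : 0 < μ) (hμ1 : μ ≤ 1) {ι : Type} [Fintype ι] (v : ι → ℝ)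
    (a : ℝ) {L : ℕ} (hL : 0 < L) {k B : ℝ} (hk : 1 ≤ k) (hkL : 32 * k ^ 2 ≤ μ * L) (hB : 0 < B)
    (J : Fin L → Finset ι) (hJ : ∀ l l', l ≠ l' → Disjoint (J l) (J l')) (Y : Fin L → Finset ℝ)
    (hY : ∀ l, (Y l : Set ℝ) ⊆ comboSet v (J l) k) (hYB : ∀ l, B ≤ (Y l).card) :
    probEta μ (fun x : ι → ℝ => ∑ i, v i * x i = a) ≤
      1 / B + Real.exp (-(μ * L / (32 * k ^ 2))) := by
  have hL0 : (0 : ℝ) < L := by exact_mod_cast hL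
  have hne : ∀ l, (Y l).Nonempty := fun l => by
    rw [← Finset.card_pos]
    exact_mod_cast hB.trans_le (hYB l)
  set τ := Real.exp (-(μ * L / (32 * k ^ 2))) with hτ
  have hpt : ∀ ξ, ∑ s : ι → Fin 3, (∏ i, etaW μ (s i)) *
      Real.cos ((∑ i, v i * etaV (s i) - a) * ξ) ≤ ∑ l, (1 / (L : ℝ)) * fejer (Y l) ξ + τ := by
    intro ξ
    refine (sum_cos_le hμ0 hμ1 v a ξ).trans ?_
    have hdisj : ∑ l, ∑ i ∈ J l, Real.sin (v i * ξ) ^ 2 ≤ ∑ i, Real.sin (v i * ξ) ^ 2 := by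
      rw [← Finset.sum_biUnion fun l _ l' _ hll => hJ l l' hll]
      exact Finset.sum_le_sum_of_subset_of_nonneg (Finset.subset_univ _)
        fun i _ _ => sq_nonneg _
    have hjensen := convexOn_exp.map_sum_le (t := (Finset.univ : Finset (Fin L)))
      (w := fun _ => 1 / (L : ℝ))
      (p := fun l => -(μ * L / 2 * ∑ i ∈ J l, Real.sin (v i * ξ) ^ 2))
      (fun _ _ => by positivity) (by simp [hL0.ne']) (fun _ _ => Set.mem_univ _)
    simp only [smul_eq_mul] at hjensen
    calc Real.exp (-(μ / 2 * ∑ i, Real.sin (v i * ξ) ^ 2))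
        ≤ Real.exp (∑ l, 1 / (L : ℝ) * -(μ * L / 2 * ∑ i ∈ J l, Real.sin (v i * ξ) ^ 2)) := by
          apply Real.exp_le_exp.2
          have : ∀ l, 1 / (L : ℝ) * -(μ * L / 2 * ∑ i ∈ J l, Real.sin (v i * ξ) ^ 2) =
              -(μ / 2) * ∑ i ∈ J l, Real.sin (v i * ξ) ^ 2 := fun l => by
            generalize ∑ i ∈ J l, Real.sin (v i * ξ) ^ 2 = S
            field_simp
          rw [Finset.sum_congr rfl fun l _ => this l, ← Finset.mul_sum]
          nlinarith
      _ ≤ _ := hjensen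
      _ ≤ ∑ l, (1 / (L : ℝ)) * (fejer (Y l) ξ + τ) := by
          gcongr with l _
          exact exp_le_fejer_add v hk hkL (hne l) (hY l) ξ
      _ = _ := by
          simp only [mul_add, Finset.sum_add_distrib, Finset.sum_const, Finset.card_univ,
            Fintype.card_fin, nsmul_eq_mul]
          field_simp
  have hleft : HasMean (fun ξ => ∑ s : ι → Fin 3, (∏ i, etaW μ (s i)) *
      Real.cos ((∑ i, v i * etaV (s i) - a) * ξ))
      (probEta μ (fun x : ι → ℝ => ∑ i, v i * x i = a)) := by
    have := HasMean.sum (Finset.univ : Finset (ι → Fin 3)) fun s _ =>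
      (hasMean_cos (∑ i, v i * etaV (s i) - a)).const_mul (∏ i, etaW μ (s i))
    simp only [sub_eq_zero] at this
    unfold probEta
    convert this
  have hright := (HasMean.sum (Finset.univ : Finset (Fin L)) fun l _ =>
    (hasMean_fejer (hne l)).const_mul (1 / (L : ℝ))).add (hasMean_const τ)
  refine (hleft.mono hright hpt).trans ?_
  gcongr
  calc ∑ l : Fin L, 1 / (L : ℝ) * (1 / ((Y l).card : ℝ))
      ≤ ∑ l : Fin L, 1 / (L : ℝ) * (1 / B) := by
        gcongr with l _
        exact hYB l
    _ = 1 / B := by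
        simp only [Finset.sum_const, Finset.card_univ, Fintype.card_fin, nsmul_eq_mul]
        field_simp

/-- Either all but few of the `v i` satisfy a bound on the number of short integer combinations of
few of them, or there are many disjoint violations of this bound. -/
theorem exists_exceptional_or_disjoint {ι : Type} [Fintype ι] [DecidableEq ι] (v : ι → ℝ) (M L : ℕ) (k B : ℝ) :
    (∃ U : Finset ι, U.card ≤ L * M ∧ ∀ J ⊆ Uᶜ, J.card ≤ M → ∀ Y : Finset ℝ,
      (Y : Set ℝ) ⊆ comboSet v J k → (Y.card : ℝ) ≤ B) ∨
    ∃ (J : Fin L → Finset ι) (Y : Fin L → Finset ℝ), (∀ l, (J l).card ≤ M) ∧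
      (∀ l l', l ≠ l' → Disjoint (J l) (J l')) ∧
      (∀ l, (Y l : Set ℝ) ⊆ comboSet v (J l) k) ∧ ∀ l, B ≤ (Y l).card := by
  induction L with
  | zero =>
    exact Or.inr ⟨Fin.elim0, Fin.elim0, fun l => l.elim0, fun l => l.elim0, fun l => l.elim0,
      fun l => l.elim0⟩
  | succ L ih =>
    rcases ih with ⟨U, hU, h⟩ | ⟨J, Y, hM, hJ, hY, hB⟩
    · exact Or.inl ⟨U, hU.trans (Nat.mul_le_mul_right _ (Nat.le_succ L)), h⟩
    by_cases hgood : ∀ J' ⊆ (Finset.univ.biUnion J)ᶜ, J'.card ≤ M → ∀ Y' : Finset ℝ,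
      (Y' : Set ℝ) ⊆ comboSet v J' k → (Y'.card : ℝ) ≤ B
    · refine Or.inl ⟨_, ?_, hgood⟩
      refine Finset.card_biUnion_le.trans ((Finset.sum_le_card_nsmul _ _ M fun l _ => hM l).trans ?_)
      simp only [Finset.card_univ, Fintype.card_fin, smul_eq_mul]
      exact Nat.mul_le_mul_right _ (Nat.le_succ L)
    · push Not at hgood
      obtain ⟨J', hJ', hJM', Y', hY', hB'⟩ := hgood
      have hdisj : ∀ l, Disjoint J' (J l) := by
        intro l
        rw [Finset.disjoint_left]
        intro i hi hil
        have := Finset.mem_compl.1 (hJ' hi)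
        exact this (Finset.mem_biUnion.2 ⟨l, Finset.mem_univ _, hil⟩)
      refine Or.inr ⟨Fin.cons J' J, Fin.cons Y' Y, Fin.cases hJM' hM, ?_, Fin.cases hY' hY,
        Fin.cases hB'.le hB⟩
      refine Fin.cases (Fin.cases (fun h => absurd rfl h) fun l _ => hdisj l) fun l =>
        Fin.cases (fun _ => (hdisj l).symm) fun l' hll => hJ l l' fun h => hll (by rw [h])

theorem etaW_nonneg {μ : ℝ} (hμ0 : 0 < μ) (hμ1 : μ ≤ 1) (k : Fin 3) : 0 ≤ etaW μ k := by
  fin_cases k <;> simp [etaW] <;> linarith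

theorem sum_prod_etaW (μ : ℝ) {ι : Type} [Fintype ι] :
    ∑ s : ι → Fin 3, ∏ i, etaW μ (s i) = 1 := by
  have h := Finset.prod_univ_sum (fun _ : ι => (Finset.univ : Finset (Fin 3))) fun _ k => etaW μ k
  rw [Fintype.piFinset_univ] at h
  rw [← h]
  refine Finset.prod_eq_one fun i _ => ?_
  simp [Fin.sum_univ_three, etaW]

theorem prod_etaW_nonneg {μ : ℝ} (hμ0 : 0 < μ) (hμ1 : μ ≤ 1) {ι : Type} [Fintype ι]
    (s : ι → Fin 3) : 0 ≤ ∏ i, etaW μ (s i) :=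
  Finset.prod_nonneg fun _ _ => etaW_nonneg hμ0 hμ1 _

theorem probEta_le_one {μ : ℝ} (hμ0 : 0 < μ) (hμ1 : μ ≤ 1) {ι : Type} [Fintype ι]
    (E : (ι → ℝ) → Prop) : probEta μ E ≤ 1 := by
  rw [← sum_prod_etaW μ (ι := ι)]
  refine Finset.sum_le_sum fun s _ => mul_le_of_le_one_right (prod_etaW_nonneg hμ0 hμ1 s) ?_
  split_ifs <;> norm_num

theorem sum_prod_etaW_mul_le {μ : ℝ} (hμ0 : 0 < μ) (hμ1 : μ ≤ 1) {ι : Type} [Fintype ι]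
    (P : (ι → ℝ) → ℝ) (hP : ∀ x, P x ≤ 1) (E : (ι → ℝ) → Prop) {δ : ℝ} (hδ : 0 ≤ δ)
    (hE : ∀ x, ¬ E x → P x ≤ δ) :
    ∑ s : ι → Fin 3, (∏ i, etaW μ (s i)) * P (fun i => etaV (s i)) ≤ probEta μ E + δ := by
  have : δ = ∑ s : ι → Fin 3, (∏ i, etaW μ (s i)) * δ := by
    rw [← Finset.sum_mul, sum_prod_etaW, one_mul]
  rw [this]
  unfold probEta
  rw [← Finset.sum_add_distrib]
  refine Finset.sum_le_sum fun s _ => ?_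
  rw [← mul_add]
  refine mul_le_mul_of_nonneg_left ?_ (prod_etaW_nonneg hμ0 hμ1 s)
  split_ifs with h
  · linarith [hP fun i => etaV (s i)]
  · linarith [hE _ h]

theorem probEta_bilinear (μ : ℝ) {ι κ : Type} [Fintype ι] [Fintype κ] (A : ι → κ → ℝ) (a : ℝ) :
    probEta μ (fun xy : (ι ⊕ κ) → ℝ =>
      ∑ i, ∑ j, A i j * xy (Sum.inl i) * xy (Sum.inr j) = a) =
    ∑ s : κ → Fin 3, (∏ j, etaW μ (s j)) *
      probEta μ (fun x : ι → ℝ => ∑ i, (∑ j, A i j * etaV (s j)) * x i = a) := by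
  have key : ∀ {_ : Fintype (ι ⊕ κ → Fin 3)} (F : (ι ⊕ κ → Fin 3) → ℝ), ∑ s, F s =
      ∑ s : κ → Fin 3, ∑ t : ι → Fin 3, F (Sum.elim t s) := by
    intro _ F
    rw [← (Equiv.sumArrowEquivProdArrow ι κ (Fin 3)).symm.sum_comp, Fintype.sum_prod_type_right]
    rfl
  unfold probEta
  refine (key _).trans (Finset.sum_congr rfl fun s _ => ?_)
  rw [Finset.mul_sum]
  refine Finset.sum_congr rfl fun t _ => ?_
  rw [Fintype.prod_sum_type]
  simp only [Sum.elim_inl, Sum.elim_inr]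
  have : ∑ i, ∑ j, A i j * etaV (t i) * etaV (s j) =
      ∑ i, (∑ j, A i j * etaV (s j)) * etaV (t i) := by
    refine Finset.sum_congr rfl fun i _ => ?_
    rw [Finset.sum_mul]
    exact Finset.sum_congr rfl fun j _ => by ring
  simp only [this]
  split_ifs <;> ring

theorem HasProperGAP.exists_isProperSymGAPSet {ι : Type} {v : ι → ℝ} {I : Finset ι} {D : ℕ}
    {B : ℝ} (h : HasProperGAP v I D B) :
    ∃ Q : Set ℝ, IsProperSymGAPSet Q D B ∧ ∀ i ∈ I, v i ∈ Q := by
  obtain ⟨r, g, N, hr, hproper, hsize, hmem⟩ := h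
  exact ⟨_, ⟨r, g, N, hr, rfl, hproper, hsize⟩, hmem⟩

theorem exists_parameters {ε μ C : ℝ} (hε : 0 < ε) (hμ : 0 < μ) :
    ∃ D : ℕ, ∀ K₀ : ℕ, ∃ n₀ : ℕ, ∀ n : ℕ, n₀ ≤ n → 1 ≤ n ∧ ∃ K : ℕ, K₀ ≤ K ∧ 1 ≤ K ∧
      (K : ℝ) ^ 12 ≤ (n : ℝ) ^ ε ∧ 10 * (n : ℝ) ^ C ≤ (K : ℝ) ^ D ∧ (K : ℝ) ^ D < 2 ^ K ∧
      Real.exp (-(μ * K ^ 2 / 32)) * K ^ D ≤ 1 ∧ 32 ≤ μ * (K : ℝ) ^ 2 := by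
  refine ⟨⌈24 * (C + 1) / ε⌉₊, fun K₀ => ?_⟩
  set D := ⌈24 * (C + 1) / ε⌉₊ with hD
  have hDC : C + 1 ≤ ε / 24 * D := by
    have := Nat.le_ceil (24 * (C + 1) / ε)
    rw [← hD, div_le_iff₀ hε] at this
    linarith
  have hpow : Filter.Tendsto (fun n : ℕ => (n : ℝ) ^ (ε / 24)) Filter.atTop Filter.atTop :=
    (tendsto_rpow_atTop (by positivity)).comp tendsto_natCast_atTop_atTop
  have hpow' : Filter.Tendsto (fun n : ℕ => (n : ℝ) ^ (ε / 12)) Filter.atTop Filter.atTop :=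
    (tendsto_rpow_atTop (by positivity)).comp tendsto_natCast_atTop_atTop
  have hKtop : Filter.Tendsto (fun n : ℕ => ⌊(n : ℝ) ^ (ε / 12)⌋₊) Filter.atTop Filter.atTop :=
    tendsto_nat_floor_atTop.comp hpow'
  have hexp : ∀ b : ℝ, 0 < b → ∀ᶠ K : ℕ in Filter.atTop, (K : ℝ) ^ D ≤ 1 / 2 * Real.exp (b * K) := by
    intro b hb
    have h := ((isLittleO_pow_exp_pos_mul_atTop D hb).bound (by norm_num : (0 : ℝ) < 1 / 2))
    filter_upwards [tendsto_natCast_atTop_atTop.eventually h] with K hK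
    simpa [abs_of_pos (Real.exp_pos _)] using hK
  have hev : ∀ᶠ K : ℕ in Filter.atTop, K₀ ≤ K ∧ 1 ≤ K ∧ (K : ℝ) ^ D < 2 ^ K ∧
      Real.exp (-(μ * K ^ 2 / 32)) * K ^ D ≤ 1 ∧ 32 ≤ μ * (K : ℝ) ^ 2 := by
    filter_upwards [Filter.eventually_ge_atTop K₀, Filter.eventually_ge_atTop 1,
      hexp (Real.log 2) (Real.log_pos (by norm_num)), hexp (μ / 32) (by positivity),
      Filter.eventually_ge_atTop ⌈32 / μ⌉₊] with K h1 h2 h3 h4 h5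
    have hK1 : (1 : ℝ) ≤ K := by exact_mod_cast h2
    have hKsq : (K : ℝ) ≤ K ^ 2 := le_self_pow₀ hK1 (by norm_num)
    refine ⟨h1, h2, ?_, ?_, ?_⟩
    · have : Real.exp (Real.log 2 * K) = 2 ^ K := by
        rw [mul_comm, Real.exp_nat_mul, Real.exp_log (by norm_num)]
      rw [this] at h3
      have : (0 : ℝ) < 2 ^ K := by positivity
      linarith
    · have h6 : (K : ℝ) ^ D ≤ Real.exp (μ * K ^ 2 / 32) := by
        have : Real.exp (μ / 32 * K) ≤ Real.exp (μ * K ^ 2 / 32) := by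
          apply Real.exp_le_exp.2
          nlinarith
        linarith [Real.exp_pos (μ / 32 * K)]
      rw [Real.exp_neg, inv_mul_le_iff₀ (Real.exp_pos _), mul_one]
      exact h6
    · have h6 : 32 / μ ≤ K := Nat.ceil_le.1 h5
      rw [div_le_iff₀ hμ] at h6
      nlinarith
  have hall : ∀ᶠ n : ℕ in Filter.atTop, 1 ≤ n ∧ ∃ K : ℕ, K₀ ≤ K ∧ 1 ≤ K ∧
      (K : ℝ) ^ 12 ≤ (n : ℝ) ^ ε ∧ 10 * (n : ℝ) ^ C ≤ (K : ℝ) ^ D ∧ (K : ℝ) ^ D < 2 ^ K ∧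
      Real.exp (-(μ * K ^ 2 / 32)) * K ^ D ≤ 1 ∧ 32 ≤ μ * (K : ℝ) ^ 2 := by
    filter_upwards [Filter.eventually_ge_atTop 10, hKtop.eventually hev,
      hpow.eventually (Filter.eventually_ge_atTop 2)] with n hn ⟨h1, h2, h3, h4, h5⟩ hn2
    have hn10 : (10 : ℝ) ≤ n := by exact_mod_cast hn
    have hn0 : (0 : ℝ) ≤ n := by linarith
    refine ⟨by omega, _, h1, h2, ?_, ?_, h3, h4, h5⟩
    · calc (⌊(n : ℝ) ^ (ε / 12)⌋₊ : ℝ) ^ 12 ≤ ((n : ℝ) ^ (ε / 12)) ^ 12 := by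
            gcongr
            exact Nat.floor_le (by positivity)
        _ = (n : ℝ) ^ ε := by
            rw [← Real.rpow_natCast, ← Real.rpow_mul hn0]
            congr 1
            push_cast
            ring
    · have hK : (n : ℝ) ^ (ε / 24) ≤ ⌊(n : ℝ) ^ (ε / 12)⌋₊ := by
        have hlt := Nat.lt_floor_add_one ((n : ℝ) ^ (ε / 12))
        have hsq : (n : ℝ) ^ (ε / 12) = (n : ℝ) ^ (ε / 24) * (n : ℝ) ^ (ε / 24) := by
          rw [← Real.rpow_add (by linarith)]
          congr 1
          ring
        nlinarith
      calc 10 * (n : ℝ) ^ C ≤ n * (n : ℝ) ^ C := by gcongr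
        _ = (n : ℝ) ^ (C + 1) := by rw [Real.rpow_add_one (by linarith), mul_comm]
        _ ≤ (n : ℝ) ^ (ε / 24 * D) := Real.rpow_le_rpow_of_exponent_le (by linarith) hDC
        _ = ((n : ℝ) ^ (ε / 24)) ^ D := by rw [Real.rpow_mul hn0, Real.rpow_natCast]
        _ ≤ _ := by gcongr
  exact Filter.eventually_atTop.1 hall

/-- If `ρ := ρ_b^{(μ)}(A) ≥ n^{-C}`, then with probability at least `(3/4)·ρ` over a random
vector `y` of iid copies of `η^μ`, there are a proper symmetric GAP `Q_y` of bounded rank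
and size at most `c/ρ` and an index set `I_y` of size at least `n - n^ε` such that
`⟨row_i(A), y⟩ ∈ Q_y` for all `i ∈ I_y`. -/
theorem rows_in_common_GAP (ε μ C : ℝ) (hε0 : 0 < ε) (hε1 : ε < 1)
    (hμ0 : 0 < μ) (hμ1 : μ ≤ 1) (hC : 0 < C) :
    ∃ r₀ : ℕ, ∃ c : ℝ, 0 < c ∧ ∃ n₀ : ℕ, ∀ n : ℕ, n₀ ≤ n →
      ∀ A : Matrix (Fin n) (Fin n) ℝ, (n : ℝ) ^ (-C) ≤ rhoBmu μ n A →
        (3 / 4) * rhoBmu μ n A ≤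
          probEta μ (fun y : Fin n → ℝ =>
            ∃ (Q : Set ℝ) (Iy : Finset (Fin n)),
              IsProperSymGAPSet Q r₀ (c / rhoBmu μ n A) ∧
              (n : ℝ) - (n : ℝ) ^ ε ≤ (Iy.card : ℝ) ∧
              ∀ i ∈ Iy, (∑ j, A i j * y j) ∈ Q) := by
  obtain ⟨D, hD⟩ := exists_parameters (C := C) hε0 hμ0
  obtain ⟨K₀, hK₀⟩ := hasProperGAP_of_card_le D
  obtain ⟨n₀, hn₀⟩ := hD K₀
  refine ⟨D, 10, by norm_num, n₀, fun n hn A hρ => ?_⟩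
  obtain ⟨hn1, K, hKK₀, hK1, hKε, hKC, hK2, hKexp, hKμ⟩ := hn₀ n hn
  set ρ := rhoBmu μ n A with hρdef
  have hnpos : (0 : ℝ) < n := by exact_mod_cast hn1
  have hnC : (0 : ℝ) < (n : ℝ) ^ (-C) := by positivity
  have hρ0 : 0 < ρ := hnC.trans_le hρ
  have hK1R : (1 : ℝ) ≤ K := by exact_mod_cast hK1
  have hKpos : (0 : ℝ) < K := by linarith
  have hBK : 10 / ρ ≤ (K : ℝ) ^ D := by
    refine le_trans ?_ hKC
    rw [div_le_iff₀ hρ0]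
    have : (n : ℝ) ^ C * (n : ℝ) ^ (-C) = 1 := by
      rw [← Real.rpow_add hnpos, add_neg_cancel, Real.rpow_zero]
    have hnC' : (0 : ℝ) < (n : ℝ) ^ C := by positivity
    nlinarith
  obtain ⟨a, ha⟩ := exists_lt_of_lt_ciSup (show 95 / 100 * ρ < rhoBmu μ n A by linarith)
  replace ha := ha.trans_eq (probEta_bilinear μ (fun i j => A i j) a)
  have hbound := sum_prod_etaW_mul_le hμ0 hμ1
    (fun y : Fin n → ℝ => probEta μ (fun x : Fin n → ℝ => ∑ i, (∑ j, A i j * y j) * x i = a))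
    (fun y => probEta_le_one hμ0 hμ1 _)
    (fun y : Fin n → ℝ => ∃ (Q : Set ℝ) (Iy : Finset (Fin n)),
      IsProperSymGAPSet Q D (10 / ρ) ∧ (n : ℝ) - (n : ℝ) ^ ε ≤ (Iy.card : ℝ) ∧
        ∀ i ∈ Iy, (∑ j, A i j * y j) ∈ Q) (δ := ρ / 5) (by positivity) ?_
  · beta_reduce at hbound
    linarith
  intro y hy
  rcases exists_exceptional_or_disjoint (fun i => ∑ j, A i j * y j) (K ^ 2) (K ^ 10)
    ((K : ℝ) ^ 4) (10 / ρ) with ⟨U, hU, hUB⟩ | ⟨J, Y, -, hJ, hY, hB⟩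
  · refine absurd ?_ hy
    have hgap := hK₀ K hKK₀ _ _ Uᶜ (10 / ρ) (hBK.trans_lt hK2) ?_ hUB
    · obtain ⟨Q, hQ, hmem⟩ := hgap.exists_isProperSymGAPSet
      refine ⟨Q, Uᶜ, hQ, ?_, hmem⟩
      have hUn : U.card ≤ n := by simpa using Finset.card_le_univ U
      have hUR : (U.card : ℝ) ≤ (K : ℝ) ^ 10 * K ^ 2 := by exact_mod_cast hU
      rw [Finset.card_compl, Fintype.card_fin, Nat.cast_sub hUn]
      have : (K : ℝ) ^ 10 * K ^ 2 = K ^ 12 := by ring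
      linarith
    · calc 10 / ρ ≤ (K : ℝ) ^ D := hBK
        _ ≤ (K : ℝ) ^ (D + 1) := pow_le_pow_right₀ hK1R (Nat.le_succ D)
        _ < ((K : ℝ) + 1) ^ (D + 1) := by gcongr; linarith
  · have hle := probEta_le hμ0 hμ1 (fun i => ∑ j, A i j * y j) a (pow_pos hK1 10)
      (one_le_pow₀ hK1R) ?_ (by positivity : 0 < 10 / ρ) J hJ Y hY hB
    · have hτ : μ * ((K ^ 10 : ℕ) : ℝ) / (32 * ((K : ℝ) ^ 4) ^ 2) = μ * K ^ 2 / 32 := by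
        push_cast
        field_simp
      rw [hτ] at hle
      have hexp : Real.exp (-(μ * K ^ 2 / 32)) ≤ ρ / 10 := by
        rw [← le_div_iff₀ (by positivity)] at hKexp
        refine hKexp.trans ?_
        rw [div_le_iff₀ (by positivity)]
        rw [div_le_iff₀ hρ0] at hBK
        linarith
      have h10 : 1 / (10 / ρ) = ρ / 10 := by field_simp
      rw [h10] at hle
      linarith
    · push_cast
      calc 32 * ((K : ℝ) ^ 4) ^ 2 ≤ μ * K ^ 2 * ((K : ℝ) ^ 4) ^ 2 := by gcongr
        _ = μ * K ^ 10 := by ring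

end
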